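/- arXiv:2007.06738 — 6 statements merged into one kernel-verified Lean document; each statement's English description precedes it below -/
import Mathlib

section
/- Suppose D > 2, lim_{α→∞} α^D / log(1/ε(α)) = μ for some μ > 0, and the stability condition holds. Then ŵ is the minimizer of Q^D_μ(w) = Σ_{i=1}^d q_D(wᵢ/μ), where q_D(z) = ∫₀^z h_D^{−1}(s) ds, over w ∈ ℝ^d subject to x_nᵀw ≥ 1 for all n ∈ {1,…,N}. -/
open Real Finset Filter Topology MeasureTheory

/-- The primitive of `g` from `0`, where `g` is frozen at `g 0` on negative times. -/
noncomputable def primitive (g : ℝ → ℝ) (t : ℝ) : ℝ := ∫ s in (0:ℝ)..t, g (max s 0)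

lemma primitive_zero (g : ℝ → ℝ) : primitive g 0 = 0 := by simp [primitive]

lemma hasDerivAt_primitive {g : ℝ → ℝ} (hg : ContinuousOn g (Set.Ici 0)) {t : ℝ} (ht : 0 ≤ t) :
    HasDerivAt (primitive g) (g t) t := by
  have hc : Continuous fun s : ℝ => g (max s 0) :=
    hg.comp_continuous (by fun_prop) fun s => le_max_right s 0
  have h := intervalIntegral.integral_hasDerivAt_right (hc.intervalIntegrable 0 t)
    hc.aestronglyMeasurable.stronglyMeasurableAtFilter hc.continuousAt
  simp only [max_eq_left ht] at h
  exact h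

lemma monotoneOn_Icc_of_hasDerivAt {f f' : ℝ → ℝ}
    (hf : ∀ t, 0 ≤ t → HasDerivAt f (f' t) t) {a : ℝ} (ha : 0 ≤ a) {b : ℝ}
    (h : ∀ t, a ≤ t → t ≤ b → 0 ≤ f' t) : MonotoneOn f (Set.Icc a b) := by
  refine monotoneOn_of_deriv_nonneg (convex_Icc a b)
    (fun t ht => (hf t (ha.trans ht.1)).continuousAt.continuousWithinAt)
    (fun t ht => ?_) (fun t ht => ?_)
  · have ht := interior_subset ht
    exact (hf t (ha.trans ht.1)).differentiableAt.differentiableWithinAt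
  · have ht := interior_subset ht
    rw [(hf t (ha.trans ht.1)).deriv]
    exact h t ht.1 ht.2

lemma eq_zero_of_hasDerivAt_zero {f : ℝ → ℝ}
    (hf : ∀ t, 0 ≤ t → HasDerivAt f 0 t) {t : ℝ} (ht : 0 ≤ t) : f t = f 0 := by
  have h1 := monotoneOn_Icc_of_hasDerivAt hf le_rfl (b := t) (fun _ _ _ => le_rfl)
    (Set.left_mem_Icc.2 ht) (Set.right_mem_Icc.2 ht) ht
  have h2 := monotoneOn_Icc_of_hasDerivAt (f := fun s => -f s) (f' := fun _ => 0)
    (fun s hs => (hf s hs).neg.congr_deriv neg_zero) le_rfl (b := t) (fun _ _ _ => le_rfl)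
    (Set.left_mem_Icc.2 ht) (Set.right_mem_Icc.2 ht) ht
  simp only at h2
  linarith

/-- Solutions of a scalar linear equation `u' = c u` keep the sign of their initial value. -/
lemma pos_of_hasDerivAt_mul {u c : ℝ → ℝ} (hc : ContinuousOn c (Set.Ici 0))
    (hu : ∀ t, 0 ≤ t → HasDerivAt u (c t * u t) t) (h0 : 0 < u 0) {t : ℝ} (ht : 0 ≤ t) :
    0 < u t := by
  have h := eq_zero_of_hasDerivAt_zero (f := fun s => u s * exp (-primitive c s))
    (fun s hs => ((hu s hs).mul (hasDerivAt_primitive hc hs).neg.exp).congr_deriv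
      (by simp only [Pi.neg_apply]; ring)) ht
  simp only [primitive_zero, neg_zero, exp_zero, mul_one] at h
  exact pos_of_mul_pos_left (h ▸ h0) (exp_pos _).le

/-- Explicit integration of `u' = D u ^ (D - 1) g`: the power `u ^ (-(D - 2))` is affine in the
primitive of `g`. -/
lemma inv_pow_eq_of_flow {D : ℕ} (hD : 2 < D) {u g : ℝ → ℝ} (hg : ContinuousOn g (Set.Ici 0))
    (hu : ∀ t, 0 ≤ t → HasDerivAt u (D * u t ^ (D - 1) * g t) t) (h0 : 0 < u 0)
    {t : ℝ} (ht : 0 ≤ t) :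
    0 < u t ∧ (u t ^ (D - 2))⁻¹ = (u 0 ^ (D - 2))⁻¹ - D * (D - 2) * primitive g t := by
  obtain ⟨m, rfl⟩ : ∃ m, D = m + 3 := ⟨D - 3, by omega⟩
  have e1 : m + 3 - 1 = m + 2 := rfl
  have e2 : m + 3 - 2 = m + 1 := rfl
  rw [e1] at hu
  rw [e2]
  have huc : ContinuousOn u (Set.Ici 0) := fun s hs => (hu s hs).continuousAt.continuousWithinAt
  have hpos : ∀ s, 0 ≤ s → 0 < u s := fun s hs =>
    pos_of_hasDerivAt_mul (c := fun s => ((m + 3 : ℕ) : ℝ) * u s ^ (m + 1) * g s)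
      ((continuousOn_const.mul (huc.pow _)).mul hg)
      (fun s hs => by convert hu s hs using 1; ring) h0 hs
  refine ⟨hpos t ht, ?_⟩
  have h := eq_zero_of_hasDerivAt_zero
    (f := fun s => (u s ^ (m + 1))⁻¹ + ((m + 3 : ℕ) : ℝ) * ((m + 3 : ℕ) - 2) * primitive g s)
    (fun s hs => ((((hu s hs).pow (m + 1)).inv (pow_ne_zero _ (hpos s hs).ne')).add
      ((hasDerivAt_primitive hg hs).const_mul _)).congr_deriv (by
        have := (hpos s hs).ne'
        push_cast [Pi.pow_apply]
        field_simp
        ring)) ht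
  simp only [primitive_zero, mul_zero, add_zero] at h
  linarith

lemma strictMonoOn_sub_rpow_neg {p : ℝ} (hp : 0 < p) :
    StrictMonoOn (fun z : ℝ => (1 - z) ^ (-p) - (1 + z) ^ (-p)) (Set.Ioo (-1) 1) := by
  intro a ha b hb hab
  have h1 : (1 - a) ^ (-p) < (1 - b) ^ (-p) :=
    rpow_lt_rpow_of_neg (by linarith [hb.2]) (by linarith) (neg_lt_zero.2 hp)
  have h2 : (1 + b) ^ (-p) < (1 + a) ^ (-p) :=
    rpow_lt_rpow_of_neg (by linarith [ha.1]) (by linarith) (neg_lt_zero.2 hp)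
  simp only
  linarith

section RightInverse

variable {h g : ℝ → ℝ} {s : Set ℝ}

lemma StrictMonoOn.strictMono_rightInverse (hh : StrictMonoOn h s) (hg : ∀ y, g y ∈ s)
    (hgh : ∀ y, h (g y) = y) : StrictMono g := fun a b hab => by
  rwa [← hh.lt_iff_lt (hg a) (hg b), hgh, hgh]

lemma StrictMonoOn.rightInverse_apply (hh : StrictMonoOn h s) (hg : ∀ y, g y ∈ s)
    (hgh : ∀ y, h (g y) = y) {z : ℝ} (hz : z ∈ s) : g (h z) = z :=
  hh.injOn (hg _) hz (hgh _)

lemma StrictMonoOn.continuous_rightInverse [s.OrdConnected] [DenselyOrdered s]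
    (hh : StrictMonoOn h s)
    (hg : ∀ y, g y ∈ s) (hgh : ∀ y, h (g y) = y) : Continuous g := by
  have hmono : Monotone fun y => (⟨g y, hg y⟩ : s) :=
    fun a b hab => (hh.strictMono_rightInverse hg hgh).monotone hab
  exact continuous_subtype_val.comp (hmono.continuous_of_surjective
    fun z => ⟨h z, Subtype.ext (hh.rightInverse_apply hg hgh z.2)⟩)

end RightInverse

/-- The subgradient inequality for the primitive of a monotone function. -/
lemma Monotone.mul_sub_le_integral_sub {g : ℝ → ℝ} (hg : Monotone g) (a b : ℝ) :
    g a * (b - a) ≤ (∫ s in (0:ℝ)..b, g s) - ∫ s in (0:ℝ)..a, g s := by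
  have hi : ∀ l r, IntervalIntegrable g volume l r := fun _ _ => hg.intervalIntegrable
  rw [intervalIntegral.integral_interval_sub_left (hi _ _) (hi _ _)]
  rcases le_total a b with hab | hab
  · have := intervalIntegral.integral_mono_on hab (f := fun _ => g a)
      intervalIntegrable_const (hi _ _) fun s hs => hg hs.1
    simp only [intervalIntegral.integral_const, smul_eq_mul] at this
    linarith
  · have := intervalIntegral.integral_mono_on hab (g := fun _ => g a)
      (hi _ _) intervalIntegrable_const fun s hs => hg hs.2
    simp only [intervalIntegral.integral_const, smul_eq_mul] at this
    rw [intervalIntegral.integral_symm]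
    linarith

section Flow

variable {d N : ℕ}

/-- The residual of the data point `x n` at time `t` for the exponential loss. -/
noncomputable def expResidual (x : Fin N → Fin d → ℝ) (w : ℝ → Fin d → ℝ) (n : Fin N) (t : ℝ) : ℝ :=
  1 / (N : ℝ) * exp (-∑ i, x n i * w t i)

/-- The exponential loss at time `t`. -/
noncomputable def expLoss (x : Fin N → Fin d → ℝ) (w : ℝ → Fin d → ℝ) (t : ℝ) : ℝ :=
  ∑ n, expResidual x w n t

/-- The negative gradient of the exponential loss with respect to the linear predictor. -/
noncomputable def force (x : Fin N → Fin d → ℝ) (w : ℝ → Fin d → ℝ) (i : Fin d) (t : ℝ) : ℝ :=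
  ∑ n, expResidual x w n t * x n i

/-- Gradient flow of the exponential loss on a diagonal linear network of depth `D` with weights
`(p, q)` and predictor `w = p ^ D - q ^ D`, started from the constant weights `a`. -/
structure DiagonalFlow (D : ℕ) (x : Fin N → Fin d → ℝ) (a : ℝ) (p q w : ℝ → Fin d → ℝ) :
    Prop where
  two_lt : 2 < D
  card_pos : 0 < N
  pos : 0 < a
  init_left : ∀ i, p 0 i = a
  init_right : ∀ i, q 0 i = a
  predictor : ∀ t i, w t i = p t i ^ D - q t i ^ D
  flow_left : ∀ t, 0 ≤ t → ∀ i,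
    HasDerivAt (fun s => p s i) (D * p t i ^ (D - 1) * force x w i t) t
  flow_right : ∀ t, 0 ≤ t → ∀ i,
    HasDerivAt (fun s => q s i) (D * q t i ^ (D - 1) * -force x w i t) t

/-- The accumulated residuals, rescaled: these play the role of dual variables. -/
noncomputable def dualVar (D : ℕ) (x : Fin N → Fin d → ℝ) (a : ℝ) (w : ℝ → Fin d → ℝ) (n : Fin N)
    (t : ℝ) : ℝ :=
  D * (D - 2) * a ^ (D - 2) * primitive (expResidual x w n) t

namespace DiagonalFlow

variable {D : ℕ} {x : Fin N → Fin d → ℝ} {a : ℝ} {p q w : ℝ → Fin d → ℝ}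

lemma residual_pos (F : DiagonalFlow D x a p q w) (n : Fin N) (t : ℝ) : 0 < expResidual x w n t := by
  have : (0 : ℝ) < N := by exact_mod_cast F.card_pos
  unfold expResidual
  positivity

lemma expLoss_pos (F : DiagonalFlow D x a p q w) (t : ℝ) : 0 < expLoss x w t :=
  Finset.sum_pos (fun n _ => F.residual_pos n t) ⟨⟨0, F.card_pos⟩, mem_univ _⟩

lemma residual_le_expLoss (F : DiagonalFlow D x a p q w) (n : Fin N) (t : ℝ) :
    expResidual x w n t ≤ expLoss x w t :=
  Finset.single_le_sum (f := fun n => expResidual x w n t) (fun m _ => (F.residual_pos m t).le)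
    (mem_univ n)

lemma expLoss_zero (F : DiagonalFlow D x a p q w) : expLoss x w 0 = 1 := by
  have : (N : ℝ) ≠ 0 := by exact_mod_cast F.card_pos.ne'
  simp [expLoss, expResidual, F.predictor, F.init_left, F.init_right, this]

lemma hasDerivAt_predictor (F : DiagonalFlow D x a p q w) {t : ℝ} (ht : 0 ≤ t) (i : Fin d) :
    HasDerivAt (fun s => w s i)
      (D ^ 2 * ((p t i ^ (D - 1)) ^ 2 + (q t i ^ (D - 1)) ^ 2) * force x w i t) t := by
  simp only [F.predictor]
  exact (((F.flow_left t ht i).pow D).sub ((F.flow_right t ht i).pow D)).congr_deriv (by ring)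

lemma hasDerivAt_residual (F : DiagonalFlow D x a p q w) {t : ℝ} (ht : 0 ≤ t) (n : Fin N) :
    HasDerivAt (expResidual x w n) (-(expResidual x w n t * ∑ i, x n i *
      (D ^ 2 * ((p t i ^ (D - 1)) ^ 2 + (q t i ^ (D - 1)) ^ 2) * force x w i t))) t := by
  have h := (((HasDerivAt.fun_sum (u := univ)
    fun i _ => (F.hasDerivAt_predictor ht i).const_mul (x n i)).fun_neg).exp).const_mul (1 / (N : ℝ))
  exact h.congr_deriv (by simp only [expResidual]; ring)

lemma hasDerivAt_expLoss (F : DiagonalFlow D x a p q w) {t : ℝ} (ht : 0 ≤ t) :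
    HasDerivAt (expLoss x w) (-∑ i, D ^ 2 * ((p t i ^ (D - 1)) ^ 2 + (q t i ^ (D - 1)) ^ 2) *
      force x w i t ^ 2) t := by
  have h := HasDerivAt.fun_sum (u := univ) fun n _ => F.hasDerivAt_residual ht n
  refine h.congr_deriv ?_
  rw [Finset.sum_neg_distrib, neg_inj]
  simp_rw [Finset.mul_sum]
  rw [Finset.sum_comm]
  refine Finset.sum_congr rfl fun i _ => ?_
  set P : ℝ := D ^ 2 * ((p t i ^ (D - 1)) ^ 2 + (q t i ^ (D - 1)) ^ 2)
  calc _ = (∑ n, expResidual x w n t * x n i) * (P * force x w i t) := by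
        rw [Finset.sum_mul]
        exact Finset.sum_congr rfl fun n _ => by ring
    _ = force x w i t * (P * force x w i t) := rfl
    _ = _ := by ring

lemma continuousOn_residual (F : DiagonalFlow D x a p q w) (n : Fin N) :
    ContinuousOn (expResidual x w n) (Set.Ici 0) :=
  fun _ ht => (F.hasDerivAt_residual ht n).continuousAt.continuousWithinAt

lemma continuousOn_force (F : DiagonalFlow D x a p q w) (i : Fin d) :
    ContinuousOn (force x w i) (Set.Ici 0) :=
  continuousOn_finsetSum _ fun n _ => (F.continuousOn_residual n).mul continuousOn_const

lemma primitive_force (F : DiagonalFlow D x a p q w) (i : Fin d) {t : ℝ} (ht : 0 ≤ t) :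
    primitive (force x w i) t = ∑ n, primitive (expResidual x w n) t * x n i := by
  have h := eq_zero_of_hasDerivAt_zero
    (f := fun s => primitive (force x w i) s - ∑ n, primitive (expResidual x w n) s * x n i)
    (fun s hs => ((hasDerivAt_primitive (F.continuousOn_force i) hs).sub
      (HasDerivAt.fun_sum (u := univ) fun n _ =>
        (hasDerivAt_primitive (F.continuousOn_residual n) hs).mul_const (x n i))).congr_deriv
      (by simp [force])) ht
  simp only [primitive_zero, zero_mul, Finset.sum_const_zero, sub_zero] at h
  linarith

lemma sum_dualVar_mul (F : DiagonalFlow D x a p q w) (i : Fin d) {t : ℝ} (ht : 0 ≤ t) :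
    ∑ n, dualVar D x a w n t * x n i =
      D * (D - 2) * a ^ (D - 2) * primitive (force x w i) t := by
  rw [F.primitive_force i ht, Finset.mul_sum]
  exact Finset.sum_congr rfl fun n _ => by rw [dualVar]; ring

lemma left_spec (F : DiagonalFlow D x a p q w) (i : Fin d) {t : ℝ} (ht : 0 ≤ t) :
    0 < p t i ∧ a ^ (D - 2) * (p t i ^ (D - 2))⁻¹ = 1 - ∑ n, dualVar D x a w n t * x n i := by
  have h := inv_pow_eq_of_flow F.two_lt (F.continuousOn_force i)
    (fun s hs => F.flow_left s hs i) (by rw [F.init_left]; exact F.pos) ht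
  refine ⟨h.1, ?_⟩
  have ha := (pow_pos F.pos (D - 2)).ne'
  rw [h.2, F.sum_dualVar_mul i ht, F.init_left]
  field_simp

lemma right_spec (F : DiagonalFlow D x a p q w) (i : Fin d) {t : ℝ} (ht : 0 ≤ t) :
    0 < q t i ∧ a ^ (D - 2) * (q t i ^ (D - 2))⁻¹ = 1 + ∑ n, dualVar D x a w n t * x n i := by
  have h := inv_pow_eq_of_flow (g := fun s => -force x w i s) F.two_lt (F.continuousOn_force i).neg
    (fun s hs => F.flow_right s hs i) (by rw [F.init_right]; exact F.pos) ht
  refine ⟨h.1, ?_⟩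
  have hneg : primitive (fun s => -force x w i s) t = -primitive (force x w i) t := by
    simp [primitive]
  have ha := (pow_pos F.pos (D - 2)).ne'
  rw [h.2, F.sum_dualVar_mul i ht, F.init_right, hneg]
  field_simp
  ring

lemma sum_dualVar_mem_Ioo (F : DiagonalFlow D x a p q w) (i : Fin d) {t : ℝ} (ht : 0 ≤ t) :
    ∑ n, dualVar D x a w n t * x n i ∈ Set.Ioo (-1 : ℝ) 1 := by
  obtain ⟨hp, hp'⟩ := F.left_spec i ht
  obtain ⟨hq, hq'⟩ := F.right_spec i ht
  have ha := F.pos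
  have h1 : 0 < a ^ (D - 2) * (p t i ^ (D - 2))⁻¹ := by positivity
  have h2 : 0 < a ^ (D - 2) * (q t i ^ (D - 2))⁻¹ := by positivity
  constructor <;> linarith

lemma pow_div_pow_eq_rpow (hD : 2 < D) {a u : ℝ} (ha : 0 < a) (hu : 0 < u) :
    (a ^ (D - 2) * (u ^ (D - 2))⁻¹) ^ (-((D : ℝ) / (D - 2))) = u ^ D / a ^ D := by
  have hD' : ((D - 2 : ℕ) : ℝ) = (D : ℝ) - 2 := by push_cast [hD.le]; ring
  have hne : (D : ℝ) - 2 ≠ 0 := by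
    have : (2 : ℝ) < D := by exact_mod_cast hD
    linarith
  rw [← div_eq_mul_inv, ← div_pow, ← rpow_natCast, ← rpow_mul (by positivity), hD',
    mul_neg, mul_div_cancel₀ _ hne, rpow_neg (by positivity), rpow_natCast, ← inv_pow, inv_div,
    div_pow]

lemma predictor_div (F : DiagonalFlow D x a p q w) (i : Fin d) {t : ℝ} (ht : 0 ≤ t) :
    w t i / a ^ D = (1 - ∑ n, dualVar D x a w n t * x n i) ^ (-((D : ℝ) / (D - 2))) -
      (1 + ∑ n, dualVar D x a w n t * x n i) ^ (-((D : ℝ) / (D - 2))) := by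
  obtain ⟨hp, hp'⟩ := F.left_spec i ht
  obtain ⟨hq, hq'⟩ := F.right_spec i ht
  rw [← hp', ← hq', pow_div_pow_eq_rpow F.two_lt F.pos hp, pow_div_pow_eq_rpow F.two_lt F.pos hq,
    F.predictor, sub_div]

/-- The two weights of a coordinate cannot both drop below the initialization scale. -/
lemma pow_le_sq_add_sq (F : DiagonalFlow D x a p q w) (i : Fin d) {t : ℝ} (ht : 0 ≤ t) :
    (a ^ (D - 1)) ^ 2 ≤ (p t i ^ (D - 1)) ^ 2 + (q t i ^ (D - 1)) ^ 2 := by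
  obtain ⟨hp, hp'⟩ := F.left_spec i ht
  obtain ⟨hq, hq'⟩ := F.right_spec i ht
  have ha := F.pos
  have key : ∀ {u : ℝ}, 0 < u → a ^ (D - 2) * (u ^ (D - 2))⁻¹ ≤ 1 → a ≤ u := fun {u} hu h => by
    rw [← div_eq_mul_inv, div_le_one (by positivity)] at h
    exact le_of_pow_le_pow_left₀ (by have := F.two_lt; omega) hu.le h
  rcases le_total 0 (∑ n, dualVar D x a w n t * x n i) with hz | hz
  · have : a ≤ p t i := key hp (by linarith)
    have : (a ^ (D - 1)) ^ 2 ≤ (p t i ^ (D - 1)) ^ 2 := by gcongr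
    nlinarith [sq_nonneg (q t i ^ (D - 1))]
  · have : a ≤ q t i := key hq (by linarith)
    have : (a ^ (D - 1)) ^ 2 ≤ (q t i ^ (D - 1)) ^ 2 := by gcongr
    nlinarith [sq_nonneg (p t i ^ (D - 1))]

/-- A lower bound for the gradient of the loss in terms of the margin `c` of a unit vector `v`. -/
lemma sq_mul_expLoss_le (F : DiagonalFlow D x a p q w) {v : Fin d → ℝ} {c : ℝ} (hc : 0 < c)
    (hv : ∑ i, v i ^ 2 = 1) (hvx : ∀ n, c ≤ ∑ i, x n i * v i) (t : ℝ) :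
    (c * expLoss x w t) ^ 2 ≤ ∑ i, force x w i t ^ 2 := by
  have h1 : c * expLoss x w t ≤ ∑ i, v i * force x w i t := by
    have : ∑ i, v i * force x w i t = ∑ n, expResidual x w n t * ∑ i, x n i * v i := by
      simp_rw [force, Finset.mul_sum]
      rw [Finset.sum_comm]
      exact Finset.sum_congr rfl fun n _ => Finset.sum_congr rfl fun i _ => by ring
    rw [this, expLoss, Finset.mul_sum]
    refine Finset.sum_le_sum fun n _ => ?_
    rw [mul_comm]
    exact mul_le_mul_of_nonneg_left (hvx n) (F.residual_pos n t).le
  have h2 := Finset.sum_mul_sq_le_sq_mul_sq univ v fun i => force x w i t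
  rw [hv, one_mul] at h2
  have h0 : 0 ≤ c * expLoss x w t := (mul_pos hc (F.expLoss_pos t)).le
  exact (pow_le_pow_left₀ h0 h1 2).trans h2

/-- The logarithm of the loss decreases at a rate proportional to the loss. -/
lemma exists_hasDerivAt_neg_log_expLoss (F : DiagonalFlow D x a p q w) {v : Fin d → ℝ} {c : ℝ}
    (hc : 0 < c) (hv : ∑ i, v i ^ 2 = 1) (hvx : ∀ n, c ≤ ∑ i, x n i * v i) :
    ∃ e : ℝ → ℝ, ∀ t, 0 ≤ t → HasDerivAt (fun s => -log (expLoss x w s)) (e t) t ∧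
      (D * a ^ (D - 1) * c) ^ 2 * expLoss x w t ≤ e t := by
  refine ⟨fun t => (∑ i, D ^ 2 * ((p t i ^ (D - 1)) ^ 2 + (q t i ^ (D - 1)) ^ 2) *
      force x w i t ^ 2) / expLoss x w t, fun t ht => ⟨?_, ?_⟩⟩
  · exact ((F.hasDerivAt_expLoss ht).log (F.expLoss_pos t).ne').neg.congr_deriv (by ring)
  · rw [le_div_iff₀ (F.expLoss_pos t)]
    calc _ = (D * a ^ (D - 1)) ^ 2 * (c * expLoss x w t) ^ 2 := by ring
      _ ≤ (D * a ^ (D - 1)) ^ 2 * ∑ i, force x w i t ^ 2 := by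
        gcongr; exact F.sq_mul_expLoss_le hc hv hvx t
      _ ≤ _ := by
        rw [Finset.mul_sum]
        refine Finset.sum_le_sum fun i _ => ?_
        rw [mul_pow]
        gcongr
        exact F.pow_le_sq_add_sq i ht

lemma dualVar_nonneg (F : DiagonalFlow D x a p q w) (n : Fin N) {t : ℝ} (ht : 0 ≤ t) :
    0 ≤ dualVar D x a w n t := by
  have h := monotoneOn_Icc_of_hasDerivAt
    (fun s hs => hasDerivAt_primitive (F.continuousOn_residual n) hs) le_rfl (b := t)
    (fun s _ _ => (F.residual_pos n s).le) (Set.left_mem_Icc.2 ht) (Set.right_mem_Icc.2 ht) ht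
  rw [primitive_zero] at h
  have hD : (2 : ℝ) < D := by exact_mod_cast F.two_lt
  have ha := F.pos
  exact mul_nonneg (mul_nonneg (mul_nonneg (by linarith) (by linarith)) (by positivity)) h

/-- If the residual of a data point is at most `δ` times the loss once `-log L` exceeds `g`, its
dual variable is controlled by `g` and `δ` times the final value of `-log L`. -/
lemma dualVar_le (F : DiagonalFlow D x a p q w) {v : Fin d → ℝ} {c : ℝ}
    (hc : 0 < c) (hv : ∑ i, v i ^ 2 = 1) (hvx : ∀ n, c ≤ ∑ i, x n i * v i) (k : Fin N)
    {S g δ : ℝ} (hS : 0 ≤ S) (hg : 0 ≤ g) (hgS : g ≤ -log (expLoss x w S)) (hδ : 0 ≤ δ)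
    (hr : ∀ t, 0 ≤ t → g ≤ -log (expLoss x w t) → -log (expLoss x w t) ≤ -log (expLoss x w S) →
      expResidual x w k t ≤ δ * expLoss x w t) :
    dualVar D x a w k S ≤
      (D - 2) / (D * c ^ 2) * (g / a ^ D + δ * (-log (expLoss x w S) / a ^ D)) := by
  obtain ⟨e, he⟩ := F.exists_hasDerivAt_neg_log_expLoss hc hv hvx
  have hD : (2 : ℝ) < D := by exact_mod_cast F.two_lt
  have ha := F.pos
  set K : ℝ := (D * a ^ (D - 1) * c) ^ 2 with hK
  have hK0 : 0 < K := by
    have : (0 : ℝ) < D := by linarith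
    positivity
  set E : ℝ → ℝ := fun s => -log (expLoss x w s) with hE
  have hEd : ∀ t, 0 ≤ t → HasDerivAt E (e t) t := fun t ht => (he t ht).1
  have hEmono : ∀ {s t}, 0 ≤ s → s ≤ t → E s ≤ E t := fun {s t} hs hst =>
    monotoneOn_Icc_of_hasDerivAt hEd hs (b := t)
      (fun u hu _ => (mul_pos hK0 (F.expLoss_pos u)).le.trans (he u (hs.trans hu)).2)
      (Set.left_mem_Icc.2 hst) (Set.right_mem_Icc.2 hst) hst
  have hE0 : E 0 = 0 := by simp [hE, F.expLoss_zero]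
  have hcont : ContinuousOn E (Set.Icc 0 S) := fun t ht =>
    (hEd t ht.1).continuousAt.continuousWithinAt
  obtain ⟨t₀, ht₀, hEt₀⟩ : ∃ t₀ ∈ Set.Icc 0 S, E t₀ = g :=
    intermediate_value_Icc hS hcont ⟨by rwa [hE0], hgS⟩
  have bound : ∀ {b l u : ℝ}, 0 ≤ b → 0 ≤ l → l ≤ u →
      (∀ t, l ≤ t → t ≤ u → expResidual x w k t ≤ b * expLoss x w t) →
      primitive (expResidual x w k) u - primitive (expResidual x w k) l ≤
        b * (E u - E l) / K := by
    intro b l u hb hl hlu h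
    have hm := monotoneOn_Icc_of_hasDerivAt (fun t ht => ((hEd t ht).const_mul (b / K)).fun_sub
      (hasDerivAt_primitive (F.continuousOn_residual k) ht)) hl (b := u)
      (fun t hlt htu => by
        have h1 : b * expLoss x w t ≤ b / K * e t := by
          rw [div_mul_eq_mul_div, le_div_iff₀ hK0]
          nlinarith [mul_le_mul_of_nonneg_left (he t (hl.trans hlt)).2 hb]
        linarith [h t hlt htu])
      (Set.left_mem_Icc.2 hlu) (Set.right_mem_Icc.2 hlu) hlu
    simp only at hm
    have : b * (E u - E l) / K = b / K * E u - b / K * E l := by ring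
    linarith
  have h1 := bound zero_le_one le_rfl ht₀.1 fun t _ _ => by
    rw [one_mul]; exact F.residual_le_expLoss k t
  have h2 := bound hδ ht₀.1 ht₀.2 fun t hlt htu =>
    hr t (ht₀.1.trans hlt) (hEt₀ ▸ hEmono ht₀.1 hlt) (hEmono (ht₀.1.trans hlt) htu)
  rw [primitive_zero, hE0, hEt₀, sub_zero, sub_zero, one_mul] at h1
  rw [hEt₀] at h2
  have h3 : δ * (E S - g) / K ≤ δ * E S / K := by gcongr; linarith
  have h4 : primitive (expResidual x w k) S ≤ (g + δ * E S) / K := by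
    rw [add_div]; linarith
  have hD2 : (0 : ℝ) ≤ D - 2 := by linarith
  calc dualVar D x a w k S ≤ D * (D - 2) * a ^ (D - 2) * ((g + δ * E S) / K) := by
        unfold dualVar; gcongr
    _ = _ := by
        obtain ⟨m, rfl⟩ : ∃ m, D = m + 3 := ⟨D - 3, by have := F.two_lt; omega⟩
        have e1 : m + 3 - 1 = m + 2 := rfl
        have e2 : m + 3 - 2 = m + 1 := rfl
        have : ((m + 3 : ℕ) : ℝ) ≠ 0 := by positivity
        have hES : -log (expLoss x w S) = E S := rfl
        rw [hK, e1, e2, hES]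
        field_simp
        ring

lemma expLoss_le_exp_neg (F : DiagonalFlow D x a p q w) {t m : ℝ}
    (hm : ∀ n, m ≤ ∑ i, x n i * w t i) : expLoss x w t ≤ exp (-m) := by
  have hN : (N : ℝ) ≠ 0 := by exact_mod_cast F.card_pos.ne'
  calc expLoss x w t ≤ ∑ _n : Fin N, 1 / (N : ℝ) * exp (-m) :=
        Finset.sum_le_sum fun n _ => by unfold expResidual; gcongr; exact hm n
    _ = exp (-m) := by simp [hN]

lemma neg_log_sub_le_margin (F : DiagonalFlow D x a p q w) (n : Fin N) (t : ℝ) :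
    -log (expLoss x w t) - log N ≤ ∑ i, x n i * w t i := by
  have hN : (0 : ℝ) < N := by exact_mod_cast F.card_pos
  have h := log_le_log (F.residual_pos n t) (F.residual_le_expLoss n t)
  rw [expResidual, log_mul (by positivity) (exp_pos _).ne', log_exp, one_div, log_inv] at h
  linarith

/-- A data point whose normalized margin is at least `ρ` has a residual which is exponentially
small relative to the loss. -/
lemma residual_le_exp_mul_expLoss (F : DiagonalFlow D x a p q w) {k : Fin N} {t m ρ : ℝ}
    (hm : IsLeast {g : ℝ | ∃ n : Fin N, g = ∑ i, x n i * w t i} m) (hρ : 1 ≤ ρ)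
    (hpos : 0 < -log (expLoss x w t) - log N) (hk : ρ ≤ (∑ i, x k i * w t i) / m) :
    expResidual x w k t ≤
      exp (-(ρ - 1) * (-log (expLoss x w t) - log N)) * expLoss x w t := by
  obtain ⟨n, hn⟩ := hm.1
  have hlow : -log (expLoss x w t) - log N ≤ m := hn ▸ F.neg_log_sub_le_margin n t
  rw [le_div_iff₀ (hpos.trans_le hlow)] at hk
  calc expResidual x w k t ≤ 1 / (N : ℝ) * exp (-(ρ - 1) * m + -m) := by
        unfold expResidual; gcongr; linarith
    _ = exp (-(ρ - 1) * m) * expResidual x w n t := by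
        rw [expResidual, ← hn, exp_add]; ring
    _ ≤ _ := by
        refine mul_le_mul (exp_le_exp.2 ?_) (F.residual_le_expLoss n t) (F.residual_pos n t).le
          (exp_pos _).le
        nlinarith

end DiagonalFlow

end Flow

/-- Approximate Karush–Kuhn–Tucker conditions imply optimality: `u` attains the minimum of the convex
function `v ↦ ∑ i, ∫ s in 0..v i / μ, g s` over `x n ⬝ v ≥ 1` if its gradient is a limit of nonnegative
combinations of the constraints whose coefficients vanish on the inactive ones. -/
lemma sum_integral_le_of_tendsto_multipliers {d N : ℕ} {g : ℝ → ℝ} (hg : Monotone g) {μ : ℝ}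
    (hμ : 0 < μ) {x : Fin N → Fin d → ℝ} {u v : Fin d → ℝ} {l : ℝ → Fin N → ℝ}
    (hl : ∀ᶠ a in atTop, ∀ n, 0 ≤ l a n)
    (hslack : ∀ k, 1 < ∑ i, x k i * u i → Tendsto (fun a => l a k) atTop (𝓝 0))
    (hgrad : ∀ i, Tendsto (fun a => ∑ n, l a n * x n i) atTop (𝓝 (g (u i / μ))))
    (hv : ∀ n, 1 ≤ ∑ i, x n i * v i) :
    ∑ i, ∫ s in (0:ℝ)..(u i / μ), g s ≤ ∑ i, ∫ s in (0:ℝ)..(v i / μ), g s := by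
  set c : Fin N → ℝ := fun n => ∑ i, x n i * (v i - u i) with hc
  have hcv : ∀ n, c n = ∑ i, x n i * v i - ∑ i, x n i * u i := fun n => by
    simp only [hc, mul_sub, Finset.sum_sub_distrib]
  have hlim : Tendsto (fun a => ∑ i, (∑ n, l a n * x n i) * (v i - u i)) atTop
      (𝓝 (∑ i, g (u i / μ) * (v i - u i))) :=
    tendsto_finsetSum _ fun i _ => (hgrad i).mul_const _
  have hlow : Tendsto (fun a => ∑ n, if 1 < ∑ i, x n i * u i then l a n * c n else 0) atTop
      (𝓝 (∑ _n : Fin N, 0)) := tendsto_finsetSum _ fun n _ => by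
    split_ifs with h
    · simpa using (hslack n h).mul_const (c n)
    · exact tendsto_const_nhds
  rw [Finset.sum_const_zero] at hlow
  have hdir : 0 ≤ ∑ i, g (u i / μ) * (v i - u i) := by
    refine le_of_tendsto_of_tendsto hlow hlim ?_
    filter_upwards [hl] with a ha
    have hswap : ∑ i, (∑ n, l a n * x n i) * (v i - u i) = ∑ n, l a n * c n := by
      simp_rw [hc, Finset.mul_sum, Finset.sum_mul]
      rw [Finset.sum_comm]
      exact Finset.sum_congr rfl fun n _ => Finset.sum_congr rfl fun i _ => by ring
    rw [hswap]
    refine Finset.sum_le_sum fun n _ => ?_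
    split_ifs with h
    · exact le_rfl
    · refine mul_nonneg (ha n) ?_
      rw [hcv]
      linarith [hv n]
  have hconv : ∑ i, g (u i / μ) * (v i - u i) / μ ≤
      ∑ i, ((∫ s in (0:ℝ)..(v i / μ), g s) - ∫ s in (0:ℝ)..(u i / μ), g s) :=
    Finset.sum_le_sum fun i _ => by
      rw [mul_div_assoc, sub_div]
      exact hg.mul_sub_le_integral_sub _ _
  rw [Finset.sum_sub_distrib, ← Finset.sum_div] at hconv
  linarith [div_nonneg hdir hμ.le]

theorem stmt10
    (d N D : ℕ) (hd : 0 < d) (hN : 0 < N) (hD : 2 < D)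
    (x : Fin N → Fin d → ℝ)
    (γ₂ : ℝ) (hγ₂pos : 0 < γ₂)
    (hγ₂ : IsGreatest {g : ℝ | ∃ v : Fin d → ℝ, (∑ i, (v i)^2) = 1 ∧ ∀ n, g ≤ ∑ i, x n i * v i} γ₂)
    (up um : ℝ → ℝ → Fin d → ℝ)
    (hinit : ∀ a : ℝ, 0 < a → ∀ i, up a 0 i = a ∧ um a 0 i = a)
    (w : ℝ → ℝ → Fin d → ℝ)
    (hw : ∀ a t i, w a t i = (up a t i)^D - (um a t i)^D)
    (Lf : ℝ → ℝ → ℝ)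
    (hLf : ∀ a t, Lf a t = (1 / (N:ℝ)) * ∑ n, Real.exp (-(∑ i, x n i * w a t i)))
    (hflowp : ∀ a : ℝ, 0 < a → ∀ t, 0 ≤ t → ∀ i, HasDerivAt (fun s => up a s i)
        (((D:ℝ)/(N:ℝ)) * (up a t i)^(D-1) * ∑ n, Real.exp (-(∑ j, x n j * w a t j)) * x n i) t)
    (hflowm : ∀ a : ℝ, 0 < a → ∀ t, 0 ≤ t → ∀ i, HasDerivAt (fun s => um a s i)
        (-(((D:ℝ)/(N:ℝ)) * (um a t i)^(D-1) * ∑ n, Real.exp (-(∑ j, x n j * w a t j)) * x n i)) t)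
    (ε : ℝ → ℝ)
    (hεanti : StrictAntiOn ε (Set.Ioi (0:ℝ)))
    (hεrange : ∀ a : ℝ, 0 < a → 0 < ε a ∧ ε a ≤ 1)
    (hεlim : Filter.Tendsto ε Filter.atTop (nhds 0))
    (T : ℝ → ℝ)
    (hT : ∀ a : ℝ, 0 < a → 0 ≤ T a ∧ Lf a (T a) = ε a)
    (γm : ℝ → ℝ → ℝ)
    (hγm : ∀ a t, IsLeast {g : ℝ | ∃ n : Fin N, g = ∑ i, x n i * w a t i} (γm a t))
    (what : Fin d → ℝ)
    (hlim : Filter.Tendsto (fun a => fun i => w a (T a) i / γm a (T a)) Filter.atTop (nhds what))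
    (hinv : ℝ → ℝ)
    (hinv_mem : ∀ y : ℝ, -1 < hinv y ∧ hinv y < 1)
    (hinv_eq : ∀ y : ℝ,
        (1 - hinv y) ^ (-(D:ℝ)/((D:ℝ)-2)) - (1 + hinv y) ^ (-(D:ℝ)/((D:ℝ)-2)) = y)
    (μ : ℝ) (hμpos : 0 < μ)
    (hμ : Filter.Tendsto (fun a => a^D / Real.log (1 / ε a)) Filter.atTop (nhds μ))
    (hstab : ∀ k : Fin N, 1 < (∑ i, x k i * what i) →
      ∃ γs : ℝ → ℝ, Filter.Tendsto (fun a => γs a / a^D) Filter.atTop (nhds 0) ∧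
      ∃ ρ₀ : ℝ, 1 < ρ₀ ∧
      ∃ A : ℝ, ∀ a, A ≤ a → ∀ t, 0 ≤ t →
        γs a ≤ -Real.log (Lf a t) → -Real.log (Lf a t) ≤ Real.log (1 / ε a) →
        ρ₀ ≤ (∑ i, x k i * w a t i) / γm a t)
    :
    (∀ n, 1 ≤ ∑ i, x n i * what i) ∧
    ∀ v : Fin d → ℝ, (∀ n, 1 ≤ ∑ i, x n i * v i) →
      (∑ i, ∫ s in (0:ℝ)..(what i / μ), hinv s) ≤
      ∑ i, ∫ s in (0:ℝ)..(v i / μ), hinv s := by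
  obtain ⟨⟨v₂, hv₂, hmargin⟩, -⟩ := hγ₂
  have hND : ∀ a t n, expResidual x (w a) n t =
      1 / (N : ℝ) * exp (-∑ i, x n i * w a t i) := fun _ _ _ => rfl
  have hforce : ∀ a t i, force x (w a) i t =
      1 / (N : ℝ) * ∑ n, exp (-∑ j, x n j * w a t j) * x n i := fun a t i => by
    simp only [force, hND, Finset.mul_sum, mul_assoc]
  have F : ∀ a, 0 < a → DiagonalFlow D x a (up a) (um a) (w a) := fun a ha =>
    { two_lt := hD
      card_pos := hN
      pos := ha
      init_left := fun i => (hinit a ha i).1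
      init_right := fun i => (hinit a ha i).2
      predictor := hw a
      flow_left := fun t ht i => (hflowp a ha t ht i).congr_deriv (by rw [hforce]; ring)
      flow_right := fun t ht i => (hflowm a ha t ht i).congr_deriv (by rw [hforce]; ring) }
  have hLoss : ∀ a t, Lf a t = expLoss x (w a) t := fun a t => by
    simp only [hLf, expLoss, hND, Finset.mul_sum]
  simp only [hLoss] at hT hstab
  have hlogT : ∀ a, 0 < a → -log (expLoss x (w a) (T a)) = log (1 / ε a) := fun a ha => by
    rw [(hT a ha).2, one_div, log_inv]
  have hpos : ∀ᶠ a : ℝ in atTop, 0 < a := eventually_gt_atTop 0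
  have hpow : Tendsto (fun a : ℝ => a ^ D) atTop atTop := tendsto_pow_atTop (by omega)
  have hlog : Tendsto (fun a => log (1 / ε a) / a ^ D) atTop (𝓝 μ⁻¹) :=
    (hμ.inv₀ hμpos.ne').congr fun a => inv_div _ _
  have hmle : ∀ a t n, γm a t ≤ ∑ i, x n i * w a t i := fun a t n => (hγm a t).2 ⟨n, rfl⟩
  have hγlim : Tendsto (fun a => γm a (T a) / a ^ D) atTop (𝓝 μ⁻¹) := by
    have hlow := hlog.sub (hpow.const_div_atTop (log N))
    rw [sub_zero] at hlow
    refine tendsto_of_tendsto_of_tendsto_of_le_of_le' hlow hlog ?_ ?_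
    · filter_upwards [hpos] with a ha
      rw [← sub_div]
      gcongr
      obtain ⟨n, hn⟩ := (hγm a (T a)).1
      rw [hn, ← hlogT a ha]
      exact (F a ha).neg_log_sub_le_margin n (T a)
    · filter_upwards [hpos] with a ha
      gcongr
      have h := log_le_log ((F a ha).expLoss_pos (T a))
        ((F a ha).expLoss_le_exp_neg (hmle a (T a)))
      rw [log_exp] at h
      linarith [hlogT a ha]
  have hγpos : ∀ᶠ a in atTop, 0 < γm a (T a) := by
    filter_upwards [hpos, hγlim.eventually_const_lt (inv_pos.2 hμpos)] with a ha h
    exact (div_pos_iff_of_pos_right (pow_pos ha D)).1 h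
  rw [tendsto_pi_nhds] at hlim
  have hfeas : ∀ n, 1 ≤ ∑ i, x n i * what i := fun n => by
    refine ge_of_tendsto (tendsto_finsetSum univ fun i _ => (hlim i).const_mul (x n i)) ?_
    filter_upwards [hγpos] with a ha
    simp_rw [← mul_div_assoc]
    rw [← Finset.sum_div, one_le_div ha]
    exact hmle a (T a) n
  have hh := strictMonoOn_sub_rpow_neg (p := (D : ℝ) / (D - 2)) (by
    have : (2 : ℝ) < D := by exact_mod_cast hD
    exact div_pos (by linarith) (by linarith))
  have hhinv : ∀ y, (fun z : ℝ => (1 - z) ^ (-((D : ℝ) / (D - 2))) -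
      (1 + z) ^ (-((D : ℝ) / (D - 2)))) (hinv y) = y := fun y => by
    simpa only [neg_div] using hinv_eq y
  refine ⟨hfeas, fun v hv => sum_integral_le_of_tendsto_multipliers
    (hh.strictMono_rightInverse hinv_mem hhinv).monotone hμpos
    (l := fun a n => dualVar D x a (w a) n (T a)) ?_ ?_ ?_ hv⟩
  · filter_upwards [hpos] with a ha n
    exact (F a ha).dualVar_nonneg n (hT a ha).1
  · intro k hk
    obtain ⟨γs, hγs, ρ, hρ, A, hA⟩ := hstab k hk
    have hg : Tendsto (fun a => max (γs a) a / a ^ D) atTop (𝓝 0) := by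
      have h1 : Tendsto (fun a : ℝ => a / a ^ D) atTop (𝓝 0) := by
        simpa using tendsto_pow_div_pow_atTop_zero (𝕜 := ℝ) (p := 1) (q := D) (by omega)
      have h2 := hγs.max h1
      rw [max_self] at h2
      refine h2.congr' ?_
      filter_upwards [hpos] with a ha
      exact max_div_div_right (pow_pos ha D).le _ _
    have hδ : Tendsto (fun a : ℝ => exp (-(ρ - 1) * (a - log N))) atTop (𝓝 0) :=
      tendsto_exp_atBot.comp ((tendsto_atTop_add_const_right _ _ tendsto_id).const_mul_atTop_of_neg
        (by linarith))
    have hbound := (hg.add (hδ.mul hlog)).const_mul (((D : ℝ) - 2) / (D * γ₂ ^ 2))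
    rw [zero_mul, add_zero, mul_zero] at hbound
    refine squeeze_zero' ?_ ?_ hbound
    · filter_upwards [hpos] with a ha
      exact (F a ha).dualVar_nonneg k (hT a ha).1
    · filter_upwards [hpos, eventually_ge_atTop A, eventually_gt_atTop (log N),
        hg.eventually_lt hlog (inv_pos.2 hμpos)] with a ha haA haN hga
      rw [div_lt_div_iff_of_pos_right (pow_pos ha D), ← hlogT a ha] at hga
      rw [← hlogT a ha]
      refine (F a ha).dualVar_le hγ₂pos hv₂ hmargin k (hT a ha).1 (ha.le.trans (le_max_right _ _))
        hga.le (exp_pos _).le fun t ht hgt htT => ?_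
      have hat : a ≤ -log (expLoss x (w a) t) := (le_max_right _ _).trans hgt
      refine ((F a ha).residual_le_exp_mul_expLoss (hγm a t) hρ.le (by linarith)
        (hA a haA t ht ((le_max_left _ _).trans hgt) (htT.trans_eq (hlogT a ha)))).trans ?_
      refine mul_le_mul_of_nonneg_right (exp_le_exp.2 ?_) ((F a ha).expLoss_pos t).le
      exact mul_le_mul_of_nonpos_left (by linarith) (by linarith)
  · intro i
    have hy : Tendsto (fun a => w a (T a) i / a ^ D) atTop (𝓝 (what i / μ)) := by
      refine ((hlim i).mul hγlim).congr' ?_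
      filter_upwards [hγpos] with a ha
      exact div_mul_div_cancel₀ ha.ne'
    refine (((hh.continuous_rightInverse hinv_mem hhinv).tendsto _).comp hy).congr' ?_
    filter_upwards [hpos] with a ha
    have hS := (hT a ha).1
    rw [Function.comp_apply, (F a ha).predictor_div i hS]
    exact hh.rightInverse_apply hinv_mem hhinv ((F a ha).sum_dualVar_mem_Ioo i hS)
end

section
/- Suppose D = 2, log(1/ε(α)) = ω(α²) as α → ∞, and the weak stability condition holds. Then ŵ is a minimizer of ‖w‖₁ over w ∈ ℝ^d subject to x_nᵀw ≥ 1 for all n ∈ {1,…,N}. -/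
open Real Finset Filter Topology MeasureTheory

/-- Along the gradient flow, `R n` is the accumulated residual of the `n`-th data point, and the
weights are determined by it. -/
theorem exists_accumulated_residual {d N : ℕ} (x : Fin N → Fin d → ℝ) {a : ℝ}
    (p m w : ℝ → Fin d → ℝ) (h0 : ∀ i, p 0 i = a ∧ m 0 i = a)
    (hw : ∀ t i, w t i = (p t i) ^ 2 - (m t i) ^ 2)
    (hp : ∀ t, 0 ≤ t → ∀ i, HasDerivAt (fun s => p s i)
      ((2 / (N : ℝ)) * p t i * ∑ n, exp (-(∑ j, x n j * w t j)) * x n i) t)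
    (hm : ∀ t, 0 ≤ t → ∀ i, HasDerivAt (fun s => m s i)
      (-((2 / (N : ℝ)) * m t i * ∑ n, exp (-(∑ j, x n j * w t j)) * x n i)) t) :
    ∃ R : ℝ → Fin N → ℝ, (∀ n, R 0 n = 0) ∧
      (∀ t, 0 ≤ t → ∀ n, HasDerivAt (fun s => R s n)
        (1 / (N : ℝ) * exp (-(∑ j, x n j * w t j))) t) ∧
      ∀ t, 0 ≤ t → ∀ i, w t i =
        a ^ 2 * (exp (4 * ∑ n, R t n * x n i) - exp (-(4 * ∑ n, R t n * x n i))) := by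
  have hwc : ∀ j, ContinuousOn (fun t => w t j) (Set.Ici 0) := by
    intro j t ht
    simp only [hw]
    exact (((hp t ht j).continuousAt.pow 2).sub
      ((hm t ht j).continuousAt.pow 2)).continuousWithinAt
  have hrc : ∀ n, Continuous
      (fun t => 1 / (N : ℝ) * exp (-(∑ j, x n j * w (max t 0) j))) := by
    intro n
    refine continuous_const.mul (continuous_exp.comp (continuous_finsetSum _ fun j _ => ?_).neg)
    exact continuous_const.mul ((hwc j).comp_continuous (continuous_id.max continuous_const)
      fun t => Set.mem_Ici.2 (le_max_right _ _))
  refine ⟨fun t n => ∫ s in (0 : ℝ)..t, 1 / (N : ℝ) * exp (-(∑ j, x n j * w (max s 0) j)),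
    fun n => intervalIntegral.integral_same, ?_⟩
  set R : ℝ → Fin N → ℝ :=
    fun t n => ∫ s in (0 : ℝ)..t, 1 / (N : ℝ) * exp (-(∑ j, x n j * w (max s 0) j)) with hR
  have hRd : ∀ t, 0 ≤ t → ∀ n, HasDerivAt (fun s => R s n)
      (1 / (N : ℝ) * exp (-(∑ j, x n j * w t j))) t := by
    intro t ht n
    have h := (hrc n).integral_hasStrictDerivAt 0 t
    simpa only [max_eq_left ht] using h.hasDerivAt
  refine ⟨hRd, ?_⟩
  have hyd : ∀ t, 0 ≤ t → ∀ i, HasDerivAt (fun s => ∑ n, R s n * x n i)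
      (∑ n, 1 / (N : ℝ) * exp (-(∑ j, x n j * w t j)) * x n i) t := fun t ht i =>
    HasDerivAt.fun_sum fun n _ => (hRd t ht n).mul_const _
  have hsum : ∀ t i, ∑ n, 1 / (N : ℝ) * exp (-(∑ j, x n j * w t j)) * x n i =
      1 / (N : ℝ) * ∑ n, exp (-(∑ j, x n j * w t j)) * x n i := by
    intro t i
    simp only [Finset.mul_sum, mul_assoc]
  have hR0 : ∀ i, ∑ n, R 0 n * x n i = 0 := by
    intro i; simp [hR]
  have hconst : ∀ (f : ℝ → ℝ), (∀ s, 0 ≤ s → HasDerivAt f 0 s) → ∀ t, 0 ≤ t → f t = f 0 :=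
    fun f hf t ht => constant_of_has_deriv_right_zero
      (fun s hs => (hf s hs.1).continuousAt.continuousWithinAt)
      (fun s hs => (hf s hs.1).hasDerivWithinAt) t ⟨ht, le_rfl⟩
  intro t ht i
  have hpt : p t i = a * exp (2 * ∑ n, R t n * x n i) := by
    have h := hconst (fun s => p s i * exp (-(2 * ∑ n, R s n * x n i))) (fun s hs => by
      refine ((hp s hs i).fun_mul ((hyd s hs i).const_mul 2).fun_neg.exp).congr_deriv ?_
      rw [hsum]; ring) t ht
    simp only [hR0, (h0 i).1, mul_zero, neg_zero, exp_zero, mul_one] at h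
    rw [← h, mul_assoc, ← exp_add]; simp
  have hmt : m t i = a * exp (-(2 * ∑ n, R t n * x n i)) := by
    have h := hconst (fun s => m s i * exp (2 * ∑ n, R s n * x n i)) (fun s hs => by
      refine ((hm s hs i).fun_mul ((hyd s hs i).const_mul 2).exp).congr_deriv ?_
      rw [hsum]; ring) t ht
    simp only [hR0, (h0 i).2, mul_zero, exp_zero, mul_one] at h
    rw [← h, mul_assoc, ← exp_add]; simp
  rw [hw, hpt, hmt, mul_pow, mul_pow, ← exp_nat_mul, ← exp_nat_mul, mul_sub]
  push_cast
  ring_nf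

/-- The gradient of the loss is bounded below through the max-margin direction `v`, so
`-log L` grows at rate at least `8 a² γ² L`. -/
theorem exists_hasDerivAt_neg_log_loss {d N : ℕ} (hN : 0 < N) (x : Fin N → Fin d → ℝ)
    {a γ : ℝ} (hγ : 0 < γ) {v : Fin d → ℝ} (hv : ∑ i, (v i) ^ 2 = 1)
    (hmargin : ∀ n, γ ≤ ∑ i, x n i * v i) (w : ℝ → Fin d → ℝ) (R : ℝ → Fin N → ℝ)
    (hR : ∀ t, 0 ≤ t → ∀ n, HasDerivAt (fun s => R s n)
      (1 / (N : ℝ) * exp (-(∑ j, x n j * w t j))) t)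
    (hw : ∀ t, 0 ≤ t → ∀ i, w t i =
      a ^ 2 * (exp (4 * ∑ n, R t n * x n i) - exp (-(4 * ∑ n, R t n * x n i))))
    (L : ℝ → ℝ) (hL : ∀ t, L t = 1 / (N : ℝ) * ∑ n, exp (-(∑ i, x n i * w t i)))
    (t : ℝ) (ht : 0 ≤ t) :
    ∃ g', HasDerivWithinAt (fun s => -log (L s)) g' (Set.Ici 0) t ∧
      8 * a ^ 2 * γ ^ 2 * L t ≤ g' := by
  have : Nonempty (Fin N) := ⟨⟨0, hN⟩⟩
  have hN' : (0 : ℝ) < N := by exact_mod_cast hN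
  have hLpos : 0 < L t := by
    rw [hL]
    exact mul_pos (by positivity) (Finset.sum_pos (fun n _ => exp_pos _) univ_nonempty)
  set r : Fin N → ℝ := fun n => 1 / (N : ℝ) * exp (-(∑ j, x n j * w t j)) with hr
  have hrpos : ∀ n, 0 < r n := fun n => mul_pos (by positivity) (exp_pos _)
  have hLr : L t = ∑ n, r n := by rw [hL, Finset.mul_sum]
  set q : Fin d → ℝ := fun i => ∑ n, r n * x n i with hq
  set z : Fin d → ℝ := fun i => 4 * ∑ n, R t n * x n i with hz
  set c : Fin d → ℝ := fun i => 4 * a ^ 2 * (exp (z i) + exp (-z i)) with hc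
  have hyd : ∀ i, HasDerivAt (fun s => 4 * ∑ n, R s n * x n i) (4 * q i) t := fun i =>
    (HasDerivAt.fun_sum fun n _ => (hR t ht n).mul_const _).const_mul 4
  have hwd : ∀ i, HasDerivWithinAt (fun s => w s i) (c i * q i) (Set.Ici 0) t := by
    intro i
    have h := (((hyd i).exp.fun_sub (hyd i).fun_neg.exp).const_mul (a ^ 2)).hasDerivWithinAt
      (s := Set.Ici 0)
    refine (h.congr (fun s hs => hw s hs i) (hw t ht i)).congr_deriv ?_
    simp only [hc, hz]; ring
  have hLd : HasDerivWithinAt L (-∑ i, c i * q i ^ 2) (Set.Ici 0) t := by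
    have h : HasDerivWithinAt (fun s => 1 / (N : ℝ) * ∑ n, exp (-(∑ i, x n i * w s i)))
        (1 / (N : ℝ) * ∑ n, exp (-(∑ i, x n i * w t i)) * (-∑ i, x n i * (c i * q i)))
        (Set.Ici 0) t :=
      (HasDerivWithinAt.fun_sum fun n _ => (HasDerivWithinAt.fun_sum fun i _ =>
        (hwd i).const_mul (x n i)).fun_neg.exp).const_mul _
    rw [funext hL]
    refine h.congr_deriv ?_
    calc _ = -∑ n, ∑ i, r n * (x n i * (c i * q i)) := by
          simp only [hr, mul_neg, Finset.sum_neg_distrib, Finset.mul_sum, mul_assoc]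
      _ = -∑ i, ∑ n, r n * (x n i * (c i * q i)) := by rw [Finset.sum_comm]
      _ = _ := by
          congr 1
          refine Finset.sum_congr rfl fun i _ => ?_
          rw [show c i * q i ^ 2 = q i * (c i * q i) by ring]
          conv_rhs => rw [hq]
          simp only [Finset.sum_mul, mul_assoc]
          rfl
  refine ⟨_, (hLd.log hLpos.ne').fun_neg, ?_⟩
  have hmq : γ * L t ≤ ∑ i, q i * v i := by
    calc γ * L t = ∑ n, r n * γ := by rw [hLr, Finset.mul_sum]; simp only [mul_comm]
      _ ≤ ∑ n, r n * ∑ i, x n i * v i :=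
        Finset.sum_le_sum fun n _ => mul_le_mul_of_nonneg_left (hmargin n) (hrpos n).le
      _ = _ := by
        simp only [hq, Finset.sum_mul, Finset.mul_sum, mul_assoc]
        rw [Finset.sum_comm]
  have hCS : (γ * L t) ^ 2 ≤ ∑ i, q i ^ 2 := by
    calc (γ * L t) ^ 2 ≤ (∑ i, q i * v i) ^ 2 := by gcongr
      _ ≤ (∑ i, q i ^ 2) * ∑ i, v i ^ 2 := Finset.sum_mul_sq_le_sq_mul_sq _ _ _
      _ = _ := by rw [hv, mul_one]
  have hcl : ∀ i, 8 * a ^ 2 ≤ c i := by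
    intro i
    have h1 : 2 ≤ exp (z i) + exp (-z i) := by
      linarith [one_le_cosh (z i), cosh_eq (z i)]
    simp only [hc]
    nlinarith [sq_nonneg a]
  have hkey : 8 * a ^ 2 * (γ * L t) ^ 2 ≤ ∑ i, c i * q i ^ 2 := by
    calc _ ≤ 8 * a ^ 2 * ∑ i, q i ^ 2 := by gcongr
      _ ≤ _ := by
        rw [Finset.mul_sum]
        exact Finset.sum_le_sum fun i _ => mul_le_mul_of_nonneg_right (hcl i) (sq_nonneg _)
  rw [neg_div, neg_neg, le_div_iff₀ hLpos]
  linarith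

/-- A quantity whose rate is at most `L`, and at most `K exp (-δ g) L` once `g ≥ b`, is bounded
when `g` grows at rate at least `c L`. -/
theorem sub_le_of_rate_le_exp_decay {g g' R r L : ℝ → ℝ} {T c b K δ : ℝ} (hT : 0 ≤ T) (hc : 0 < c)
    (hK : 0 ≤ K) (hδ : 0 < δ) (hg0 : g 0 = 0)
    (hg : ∀ t, 0 ≤ t → HasDerivWithinAt g (g' t) (Set.Ici 0) t)
    (hR : ∀ t, 0 ≤ t → HasDerivWithinAt R (r t) (Set.Ici 0) t)
    (hL : ∀ t, 0 ≤ L t) (hgL : ∀ t, 0 ≤ t → c * L t ≤ g' t)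
    (hrL : ∀ t, 0 ≤ t → r t ≤ L t)
    (hrK : ∀ t, 0 ≤ t → b ≤ g t → g t ≤ g T → r t ≤ K * exp (-(δ * g t)) * L t) :
    R T - R 0 ≤ max b 0 / c + K / (δ * c) := by
  have hanti : ∀ (f f' : ℝ → ℝ) (s : ℝ), 0 ≤ s →
      (∀ t, 0 ≤ t → HasDerivWithinAt f (f' t) (Set.Ici 0) t) →
      (∀ t, s ≤ t → t ≤ T → f' t ≤ 0) → AntitoneOn f (Set.Icc s T) := by
    intro f f' s hs hf hf'
    refine antitoneOn_of_hasDerivWithinAt_nonpos (f' := f') (convex_Icc s T)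
      (fun t ht => ((hf t (hs.trans ht.1)).continuousWithinAt).mono
        fun y hy => hs.trans hy.1) (fun t ht => ?_) (fun t ht => ?_)
    · rw [interior_Icc] at ht ⊢
      exact (hf t (hs.trans ht.1.le)).mono fun y hy => hs.trans hy.1.le
    · rw [interior_Icc] at ht
      exact hf' t ht.1.le ht.2.le
  have hg'0 : ∀ t, 0 ≤ t → 0 ≤ g' t := fun t ht => (mul_nonneg hc.le (hL t)).trans (hgL t ht)
  have hmono : MonotoneOn g (Set.Icc 0 T) := by
    have h := hanti (fun t => -g t) (fun t => -g' t) 0 le_rfl (fun t ht => (hg t ht).fun_neg)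
      fun t ht _ => neg_nonpos.2 (hg'0 t ht)
    exact fun y hy z hz hyz => neg_le_neg_iff.1 (h hy hz hyz)
  have hslow : AntitoneOn (fun t => c * R t - g t) (Set.Icc 0 T) :=
    hanti _ (fun t => c * r t - g' t) 0 le_rfl (fun t ht => ((hR t ht).const_mul c).sub (hg t ht))
      fun t ht _ => by nlinarith [hgL t ht, hrL t ht]
  have hzero : ∀ s ∈ Set.Icc 0 T, c * (R s - R 0) ≤ g s := by
    intro s hs
    have := hslow ⟨le_rfl, hT⟩ hs hs.1
    simp only [hg0] at this
    linarith
  have hKc : 0 ≤ K / (δ * c) := by positivity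
  rcases le_total (g T) (max b 0) with hbT | hbT
  · have h := (hzero T ⟨hT, le_rfl⟩).trans hbT
    have : R T - R 0 ≤ max b 0 / c := by rw [le_div_iff₀ hc]; linarith
    linarith
  · obtain ⟨s, hs, hgs⟩ := intermediate_value_Icc hT
      (fun t ht => ((hg t ht.1).continuousWithinAt).mono fun y hy => hy.1)
      (show max b 0 ∈ Set.Icc (g 0) (g T) from ⟨by rw [hg0]; exact le_max_right _ _, hbT⟩)
    have hfast : AntitoneOn (fun t => c * R t + K / δ * exp (-(δ * g t))) (Set.Icc s T) := by
      refine hanti _ (fun t => c * r t + K / δ * (exp (-(δ * g t)) * (-(δ * g' t)))) s hs.1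
        (fun t ht => ((hR t ht).const_mul c).add
          ((((hg t ht).const_mul δ).fun_neg.exp).const_mul _)) fun t hst htT => ?_
      have ht := hs.1.trans hst
      have hbg : b ≤ g t := (le_max_left b 0).trans (hgs ▸ hmono hs ⟨ht, htT⟩ hst)
      have h1 := mul_le_mul_of_nonneg_left (hrK t ht hbg (hmono ⟨ht, htT⟩ ⟨hT, le_rfl⟩ htT)) hc.le
      have h2 := mul_le_mul_of_nonneg_left (hgL t ht)
        (mul_nonneg hK (exp_pos (-(δ * g t))).le)
      have h3 : K / δ * (exp (-(δ * g t)) * (-(δ * g' t))) = -(K * exp (-(δ * g t)) * g' t) := by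
        field_simp
      rw [h3]
      linarith
    have h1 := hfast ⟨le_rfl, hs.2⟩ ⟨hs.2, le_rfl⟩ hs.2
    have h2 := hzero s hs
    have h3 : exp (-(δ * g s)) ≤ 1 := by
      rw [exp_le_one_iff, hgs, neg_nonpos]
      exact mul_nonneg hδ.le (le_max_right _ _)
    have h4 : 0 ≤ K / δ * exp (-(δ * g T)) := by positivity
    have h5 : K / δ * exp (-(δ * g s)) ≤ K / δ := mul_le_of_le_one_right (by positivity) h3
    have h6 : max b 0 / c + K / (δ * c) = (max b 0 + K / δ) / c := by field_simp
    rw [h6, le_div_iff₀ hc]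
    simp only at h1
    rw [hgs] at h2
    linarith

/-- If `s (e^z - e^{-z})` is at most `C s e^ℓ` in absolute value, then `|z| ≤ ℓ + log (1 + C)`. -/
theorem abs_le_add_log_of_abs_exp_sub_exp_le {z ℓ C s : ℝ} (hs : 0 < s) (hC : 0 ≤ C) (hℓ : 0 ≤ ℓ)
    (h : |s * (exp z - exp (-z))| ≤ C * (s * exp ℓ)) : |z| ≤ ℓ + log (1 + C) := by
  rw [abs_mul, abs_of_pos hs, mul_left_comm, mul_le_mul_iff_right₀ hs] at h
  have h1 : exp |z| ≤ 1 + C * exp ℓ := by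
    rcases le_total 0 z with hz | hz
    · rw [abs_of_nonneg hz]
      have := exp_le_one_iff.2 (neg_nonpos.2 hz)
      linarith [le_abs_self (exp z - exp (-z))]
    · rw [abs_of_nonpos hz]
      have := exp_le_one_iff.2 hz
      linarith [neg_abs_le (exp z - exp (-z))]
  rw [← exp_le_exp, exp_add, exp_log (by linarith)]
  nlinarith [one_le_exp hℓ]

/-- If `s (e^z - e^{-z})` is at least `C s e^ℓ`, then `z ≥ ℓ + log C`. -/
theorem add_log_le_of_le_exp_sub_exp {z ℓ C s : ℝ} (hs : 0 < s) (hC : 0 < C)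
    (h : C * (s * exp ℓ) ≤ s * (exp z - exp (-z))) : ℓ + log C ≤ z := by
  rw [mul_left_comm, mul_le_mul_iff_right₀ hs] at h
  rw [← exp_le_exp, exp_add, exp_log hC]
  linarith [exp_pos (-z)]

/-- The loss of the minimal margin `γ` satisfies `e^{-γ} / N ≤ L ≤ e^{-γ}`. -/
theorem margin_le_neg_log_loss_le {N : ℕ} (hN : 0 < N) {f : Fin N → ℝ} {γ L : ℝ}
    (hγ : IsLeast {g : ℝ | ∃ n : Fin N, g = f n} γ)
    (hL : L = 1 / (N : ℝ) * ∑ n, exp (-f n)) :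
    0 < L ∧ 1 / (N : ℝ) * exp (-γ) ≤ L ∧ γ ≤ -log L ∧ -log L ≤ γ + log N := by
  have hN' : (0 : ℝ) < N := by exact_mod_cast hN
  obtain ⟨⟨k, hk⟩, hmin⟩ := hγ
  have hlow : 1 / (N : ℝ) * exp (-γ) ≤ L := by
    rw [hL, hk]
    gcongr
    exact Finset.single_le_sum (f := fun n => exp (-f n)) (fun n _ => (exp_pos _).le)
      (Finset.mem_univ k)
  have hpos : 0 < L := lt_of_lt_of_le (by positivity) hlow
  have hup : L ≤ exp (-γ) := by
    calc L ≤ 1 / (N : ℝ) * ∑ _n : Fin N, exp (-γ) := by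
          rw [hL]; gcongr with n; exact hmin ⟨n, rfl⟩
      _ = exp (-γ) := by simp [hN'.ne']
  refine ⟨hpos, hlow, ?_, ?_⟩
  · have := log_le_log hpos hup
    rw [log_exp] at this
    linarith
  · have := log_le_log (by positivity) hlow
    rw [log_mul (by positivity) (exp_pos _).ne', log_exp, one_div, log_inv] at this
    linarith

/-- Under a margin ratio of at least `ρ > 1`, the residual of a point is exponentially smaller than
the loss. -/
theorem residual_le_of_margin_ratio {N : ℕ} (hN : 0 < N) {f : Fin N → ℝ} {γ L ρ : ℝ}
    (hγ : IsLeast {g : ℝ | ∃ n : Fin N, g = f n} γ)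
    (hL : L = 1 / (N : ℝ) * ∑ n, exp (-f n)) (hρ : 1 < ρ) {k : Fin N} (hk : ρ ≤ f k / γ) :
    1 / (N : ℝ) * exp (-f k) ≤ exp ((ρ - 1) * log N) * exp (-((ρ - 1) * -log L)) * L := by
  obtain ⟨hLpos, hlow, -, hup⟩ := margin_le_neg_log_loss_le hN hγ hL
  have hγk : γ ≤ f k := hγ.2 ⟨k, rfl⟩
  have hγpos : 0 < γ := by
    rcases lt_trichotomy γ 0 with h | h | h
    · rw [le_div_iff_of_neg h] at hk
      nlinarith
    · rw [h, div_zero] at hk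
      linarith
    · exact h
  rw [le_div_iff₀ hγpos] at hk
  calc 1 / (N : ℝ) * exp (-f k) ≤ 1 / (N : ℝ) * exp (-γ + -((ρ - 1) * γ)) := by
        gcongr; linarith
    _ = exp (-((ρ - 1) * γ)) * (1 / (N : ℝ) * exp (-γ)) := by rw [exp_add]; ring
    _ ≤ exp ((ρ - 1) * log N + -((ρ - 1) * -log L)) * L := by
        gcongr
        nlinarith
    _ = _ := by rw [exp_add]

/-- At time `T`, the weights are determined by nonnegative accumulated residuals, and a residual
which decays relative to the loss once `-log L ≥ b` has a small accumulated value. -/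
theorem exists_terminal_residual {d N : ℕ} (hN : 0 < N) (x : Fin N → Fin d → ℝ) {a γ T : ℝ}
    (ha : 0 < a) (hT : 0 ≤ T) (hγ : 0 < γ) {v : Fin d → ℝ} (hv : ∑ i, (v i) ^ 2 = 1)
    (hmargin : ∀ n, γ ≤ ∑ i, x n i * v i)
    (p m w : ℝ → Fin d → ℝ) (h0 : ∀ i, p 0 i = a ∧ m 0 i = a)
    (hw : ∀ t i, w t i = (p t i) ^ 2 - (m t i) ^ 2)
    (hp : ∀ t, 0 ≤ t → ∀ i, HasDerivAt (fun s => p s i)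
      ((2 / (N : ℝ)) * p t i * ∑ n, exp (-(∑ j, x n j * w t j)) * x n i) t)
    (hm : ∀ t, 0 ≤ t → ∀ i, HasDerivAt (fun s => m s i)
      (-((2 / (N : ℝ)) * m t i * ∑ n, exp (-(∑ j, x n j * w t j)) * x n i)) t)
    (L : ℝ → ℝ) (hL : ∀ t, L t = 1 / (N : ℝ) * ∑ n, exp (-(∑ i, x n i * w t i))) :
    ∃ ρ : Fin N → ℝ, (∀ n, 0 ≤ ρ n) ∧
      (∀ i, w T i = a ^ 2 * (exp (4 * ∑ n, ρ n * x n i) - exp (-(4 * ∑ n, ρ n * x n i)))) ∧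
      ∀ (k : Fin N) (b K δ : ℝ), 0 ≤ K → 0 < δ →
        (∀ t, 0 ≤ t → b ≤ -log (L t) → -log (L t) ≤ -log (L T) →
          1 / (N : ℝ) * exp (-(∑ i, x k i * w t i)) ≤ K * exp (-(δ * -log (L t))) * L t) →
        ρ k ≤ max b 0 / (8 * a ^ 2 * γ ^ 2) + K / (δ * (8 * a ^ 2 * γ ^ 2)) := by
  obtain ⟨R, hR0, hR, hwR⟩ := exists_accumulated_residual x p m w h0 hw hp hm
  have hg := exists_hasDerivAt_neg_log_loss hN x hγ hv hmargin w R hR hwR L hL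
  choose! g' hg hgL using hg
  have hN' : (0 : ℝ) < N := by exact_mod_cast hN
  have hrpos : ∀ t n, 0 ≤ 1 / (N : ℝ) * exp (-(∑ j, x n j * w t j)) := fun t n => by positivity
  have hLsum : ∀ t, L t = ∑ n, 1 / (N : ℝ) * exp (-(∑ i, x n i * w t i)) := fun t => by
    rw [hL, Finset.mul_sum]
  have hL0 : L 0 = 1 := by
    simp [hL, hw, h0, hN'.ne']
  refine ⟨R T, fun n => ?_, hwR T hT, fun k b K δ hK hδ hdecay => ?_⟩
  · have hmono : MonotoneOn (fun s => R s n) (Set.Icc 0 T) := by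
      refine monotoneOn_of_hasDerivWithinAt_nonneg (convex_Icc 0 T)
        (f' := fun t => 1 / (N : ℝ) * exp (-(∑ j, x n j * w t j)))
        (fun t ht => (hR t ht.1 n).continuousAt.continuousWithinAt) (fun t ht => ?_)
        (fun t ht => hrpos t n)
      rw [interior_Icc] at ht
      exact (hR t ht.1.le n).hasDerivWithinAt
    simpa [hR0] using hmono ⟨le_rfl, hT⟩ ⟨hT, le_rfl⟩ hT
  · have h := sub_le_of_rate_le_exp_decay (g := fun t => -log (L t)) (g' := g')
      (R := fun t => R t k) (L := L) (b := b) (c := 8 * a ^ 2 * γ ^ 2) hT (by positivity) hK hδ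
      (by simp [hL0]) hg (fun t ht => (hR t ht k).hasDerivWithinAt)
      (fun t => by rw [hLsum]; exact Finset.sum_nonneg fun n _ => hrpos t n) hgL
      (fun t _ => by
        rw [hLsum]
        exact Finset.single_le_sum (f := fun n => 1 / (N : ℝ) * exp (-(∑ i, x n i * w t i)))
          (fun n _ => hrpos t n) (Finset.mem_univ k)) hdecay
    simpa [hR0] using h

/-- Coordinates `z` with `w = s (e^z - e^{-z})`, where `w / γ → u` and `γ` is comparable to
`s e^ℓ`, satisfy `z = ℓ sign u + O(1)` when `u ≠ 0`, and `|z| ≤ ℓ + O(1)` in any case. -/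
theorem eventually_abs_le_and_le_mul {z w γ s ℓ : ℝ → ℝ} {u : ℝ}
    (hs : ∀ᶠ a in atTop, 0 < s a) (hℓ : ∀ᶠ a in atTop, 0 ≤ ℓ a)
    (hγ : ∀ᶠ a in atTop, s a * exp (ℓ a) / 2 ≤ γ a ∧ γ a ≤ s a * exp (ℓ a))
    (hw : ∀ᶠ a in atTop, w a = s a * (exp (z a) - exp (-z a)))
    (hu : Tendsto (fun a => w a / γ a) atTop (𝓝 u)) :
    ∃ K : ℝ, ∀ᶠ a in atTop, |z a| ≤ ℓ a + K ∧ |u| * ℓ a - K ≤ u * z a := by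
  have hupper : ∀ᶠ a in atTop, |z a| ≤ ℓ a + log (1 + (|u| + 1)) := by
    filter_upwards [hs, hℓ, hγ, hw, hu.abs.eventually_le_const (lt_add_one |u|)]
      with a hs hℓ hγ hw hu
    have hγ0 : 0 < γ a := lt_of_lt_of_le (by positivity) hγ.1
    refine abs_le_add_log_of_abs_exp_sub_exp_le hs (by positivity) hℓ ?_
    rw [← hw]
    rw [abs_div, abs_of_pos hγ0, div_le_iff₀ hγ0] at hu
    exact hu.trans (by gcongr; exact hγ.2)
  have hlower : ∃ K : ℝ, ∀ᶠ a in atTop, |u| * ℓ a - K ≤ u * z a := by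
    rcases lt_trichotomy u 0 with h | h | h
    · refine ⟨u * log (-u / 4), ?_⟩
      filter_upwards [hs, hγ, hw, hu.eventually_le_const (show u < u / 2 by linarith)]
        with a hs hγ hw hu
      have hγ0 : 0 < γ a := lt_of_lt_of_le (by positivity) hγ.1
      rw [div_le_iff₀ hγ0] at hu
      have := add_log_le_of_le_exp_sub_exp (z := -z a) (ℓ := ℓ a) (C := -u / 4) hs
        (by linarith) (by rw [neg_neg]; nlinarith [hγ.1])
      rw [abs_of_neg h]
      nlinarith
    · exact ⟨0, Eventually.of_forall fun a => by simp [h]⟩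
    · refine ⟨-(u * log (u / 4)), ?_⟩
      filter_upwards [hs, hγ, hw, hu.eventually_const_le (show u / 2 < u by linarith)]
        with a hs hγ hw hu
      have hγ0 : 0 < γ a := lt_of_lt_of_le (by positivity) hγ.1
      rw [le_div_iff₀ hγ0] at hu
      have := add_log_le_of_le_exp_sub_exp (z := z a) (ℓ := ℓ a) (C := u / 4) hs
        (by linarith) (by nlinarith [hγ.1])
      rw [abs_of_pos h]
      nlinarith
  obtain ⟨K, hK⟩ := hlower
  refine ⟨max (log (1 + (|u| + 1))) K, ?_⟩
  filter_upwards [hupper, hK] with a h1 h2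
  exact ⟨h1.trans (by gcongr; exact le_max_left _ _),
    le_trans (by gcongr; exact le_max_right _ _) h2⟩

/-- Asymptotic dual certificate: if `z = 4 ∑ ρ n x n` aligns with `u` at scale `ℓ → ∞` and the
multipliers of the slack constraints are `o(ℓ)`, then `u` has minimal `ℓ¹` norm among feasible
points. -/
theorem sum_abs_le_of_asymptotic_certificate {d N : ℕ} (x : Fin N → Fin d → ℝ) {u v : Fin d → ℝ}
    {ρ : ℝ → Fin N → ℝ} {ℓ : ℝ → ℝ} (hℓ : Tendsto ℓ atTop atTop)
    (hρ : ∀ᶠ a in atTop, ∀ n, 0 ≤ ρ a n)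
    (hslack : ∀ k, 1 < ∑ i, x k i * u i → Tendsto (fun a => ρ a k / ℓ a) atTop (𝓝 0))
    (halign : ∀ i, ∃ K : ℝ, ∀ᶠ a in atTop, |4 * ∑ n, ρ a n * x n i| ≤ ℓ a + K ∧
      |u i| * ℓ a - K ≤ u i * (4 * ∑ n, ρ a n * x n i))
    (hv : ∀ n, 1 ≤ ∑ i, x n i * v i) : ∑ i, |u i| ≤ ∑ i, |v i| := by
  choose K hK using halign
  set s : Fin N → ℝ := fun n =>
    if 1 < ∑ i, x n i * u i then |∑ i, x n i * v i - ∑ i, x n i * u i| else 0 with hs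
  have hσ : Tendsto (fun a => ∑ n, ρ a n / ℓ a * s n) atTop (𝓝 0) := by
    rw [← Finset.sum_const_zero (s := (Finset.univ : Finset (Fin N)))]
    refine tendsto_finsetSum _ fun n _ => ?_
    by_cases h : 1 < ∑ i, x n i * u i
    · simpa using (hslack n h).mul_const (s n)
    · simp [hs, h]
  have hinv : Tendsto (fun a => (ℓ a)⁻¹) atTop (𝓝 0) := hℓ.inv_tendsto_atTop
  have hlim1 : Tendsto (fun a => ∑ i, |u i| - (∑ i, K i) * (ℓ a)⁻¹) atTop (𝓝 (∑ i, |u i|)) := by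
    simpa using tendsto_const_nhds.sub (hinv.const_mul (∑ i, K i))
  have hlim2 : Tendsto (fun a => ∑ i, |v i| + (∑ i, |v i| * K i) * (ℓ a)⁻¹ +
      4 * ∑ n, ρ a n / ℓ a * s n) atTop (𝓝 (∑ i, |v i|)) := by
    simpa using (tendsto_const_nhds.add (hinv.const_mul (∑ i, |v i| * K i))).add (hσ.const_mul 4)
  refine le_of_tendsto_of_tendsto hlim1 hlim2 ?_
  filter_upwards [hρ, eventually_all.2 hK, hℓ.eventually_gt_atTop 0] with a hρ hK hℓ
  have hlow : (∑ i, |u i|) * ℓ a - ∑ i, K i ≤ ∑ i, u i * (4 * ∑ n, ρ a n * x n i) := by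
    rw [Finset.sum_mul, ← Finset.sum_sub_distrib]
    exact Finset.sum_le_sum fun i _ => (hK i).2
  have hup : ∑ i, v i * (4 * ∑ n, ρ a n * x n i) ≤
      (∑ i, |v i|) * ℓ a + ∑ i, |v i| * K i := by
    rw [Finset.sum_mul, ← Finset.sum_add_distrib]
    refine Finset.sum_le_sum fun i _ => ?_
    rw [← mul_add]
    refine (le_abs_self _).trans ?_
    rw [abs_mul]
    exact mul_le_mul_of_nonneg_left (hK i).1 (abs_nonneg _)
  have hswap : ∀ y : Fin d → ℝ, ∑ i, y i * (4 * ∑ n, ρ a n * x n i) =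
      4 * ∑ n, ρ a n * ∑ i, x n i * y i := by
    intro y
    simp only [Finset.mul_sum]
    rw [Finset.sum_comm]
    refine Finset.sum_congr rfl fun n _ => Finset.sum_congr rfl fun i _ => by ring
  have hcs : ∑ n, ρ a n * ∑ i, x n i * u i ≤
      ∑ n, ρ a n * ∑ i, x n i * v i + ∑ n, ρ a n * s n := by
    rw [← Finset.sum_add_distrib]
    refine Finset.sum_le_sum fun n _ => ?_
    rw [← mul_add]
    refine mul_le_mul_of_nonneg_left ?_ (hρ n)
    by_cases h : 1 < ∑ i, x n i * u i
    · simp only [hs, if_pos h]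
      linarith [neg_abs_le (∑ i, x n i * v i - ∑ i, x n i * u i)]
    · simp only [hs, if_neg h]
      linarith [hv n]
  rw [hswap] at hlow hup
  have hdiv : ∑ n, ρ a n / ℓ a * s n = (∑ n, ρ a n * s n) * (ℓ a)⁻¹ := by
    rw [Finset.sum_mul]
    exact Finset.sum_congr rfl fun n _ => by ring
  rw [hdiv, ← mul_le_mul_iff_left₀ hℓ]
  field_simp
  linarith

theorem stmt11
    (d N D : ℕ) (hd : 0 < d) (hN : 0 < N) (hD : 2 ≤ D) (hD2 : D = 2)
    (x : Fin N → Fin d → ℝ)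
    (γ₂ : ℝ) (hγ₂pos : 0 < γ₂)
    (hγ₂ : IsGreatest {g : ℝ | ∃ v : Fin d → ℝ, (∑ i, (v i)^2) = 1 ∧ ∀ n, g ≤ ∑ i, x n i * v i} γ₂)
    (up um : ℝ → ℝ → Fin d → ℝ)
    (hinit : ∀ a : ℝ, 0 < a → ∀ i, up a 0 i = a ∧ um a 0 i = a)
    (w : ℝ → ℝ → Fin d → ℝ)
    (hw : ∀ a t i, w a t i = (up a t i)^D - (um a t i)^D)
    (Lf : ℝ → ℝ → ℝ)
    (hLf : ∀ a t, Lf a t = (1 / (N:ℝ)) * ∑ n, Real.exp (-(∑ i, x n i * w a t i)))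
    (hflowp : ∀ a : ℝ, 0 < a → ∀ t, 0 ≤ t → ∀ i, HasDerivAt (fun s => up a s i)
        (((D:ℝ)/(N:ℝ)) * (up a t i)^(D-1) * ∑ n, Real.exp (-(∑ j, x n j * w a t j)) * x n i) t)
    (hflowm : ∀ a : ℝ, 0 < a → ∀ t, 0 ≤ t → ∀ i, HasDerivAt (fun s => um a s i)
        (-(((D:ℝ)/(N:ℝ)) * (um a t i)^(D-1) * ∑ n, Real.exp (-(∑ j, x n j * w a t j)) * x n i)) t)
    (ε : ℝ → ℝ)
    (hεanti : StrictAntiOn ε (Set.Ioi (0:ℝ)))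
    (hεrange : ∀ a : ℝ, 0 < a → 0 < ε a ∧ ε a ≤ 1)
    (hεlim : Filter.Tendsto ε Filter.atTop (nhds 0))
    (T : ℝ → ℝ)
    (hT : ∀ a : ℝ, 0 < a → 0 ≤ T a ∧ Lf a (T a) = ε a)
    (γm : ℝ → ℝ → ℝ)
    (hγm : ∀ a t, IsLeast {g : ℝ | ∃ n : Fin N, g = ∑ i, x n i * w a t i} (γm a t))
    (what : Fin d → ℝ)
    (hlim : Filter.Tendsto (fun a => fun i => w a (T a) i / γm a (T a)) Filter.atTop (nhds what))
    (hfast : Filter.Tendsto (fun a => Real.log (1 / ε a) / a^2) Filter.atTop Filter.atTop)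
    (hstab : ∀ k : Fin N, 1 < (∑ i, x k i * what i) →
      ∃ γs : ℝ → ℝ,
        Filter.Tendsto (fun a => γs a / (a^2 * Real.log (Real.log (1 / ε a) / a^2)))
          Filter.atTop (nhds 0) ∧
      ∃ ρ₀ : ℝ, 1 < ρ₀ ∧
      ∃ A : ℝ, ∀ a, A ≤ a → ∀ t, 0 ≤ t →
        γs a ≤ -Real.log (Lf a t) → -Real.log (Lf a t) ≤ Real.log (1 / ε a) →
        ρ₀ ≤ (∑ i, x k i * w a t i) / γm a t)
    :
    (∀ n, 1 ≤ ∑ i, x n i * what i) ∧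
    ∀ v : Fin d → ℝ, (∀ n, 1 ≤ ∑ i, x n i * v i) →
      (∑ i, |what i|) ≤ ∑ i, |v i| := by
  subst hD2
  obtain ⟨v₀, hv₀, hm₀⟩ := hγ₂.1
  have hres : ∀ a : ℝ, 0 < a → _ := fun a ha =>
    exists_terminal_residual hN x ha (hT a ha).1 hγ₂pos hv₀ hm₀ (up a) (um a) (w a) (hinit a ha)
      (hw a) (by simpa using hflowp a ha) (by simpa using hflowm a ha) (Lf a) (hLf a)
  choose! ρ hρ hwρ hρle using hres
  have hpos : ∀ᶠ a : ℝ in atTop, 0 < a := eventually_gt_atTop 0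
  set ℓ : ℝ → ℝ := fun a => log (log (1 / ε a) / a ^ 2) with hℓdef
  have hℓ : Tendsto ℓ atTop atTop := tendsto_log_atTop.comp hfast
  have hexpℓ : ∀ᶠ a in atTop, a ^ 2 * exp (ℓ a) = log (1 / ε a) := by
    filter_upwards [hpos, hfast.eventually_gt_atTop 0] with a ha h
    rw [hℓdef, exp_log h]
    field_simp
  have hΛ : Tendsto (fun a => log (1 / ε a)) atTop atTop :=
    ((tendsto_pow_atTop two_ne_zero).atTop_mul_atTop₀ (tendsto_exp_atTop.comp hℓ)).congr' hexpℓ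
  have hLT : ∀ a, 0 < a → -log (Lf a (T a)) = log (1 / ε a) := fun a ha => by
    rw [(hT a ha).2, one_div, log_inv]
  have hγ : ∀ᶠ a in atTop, a ^ 2 * exp (ℓ a) / 2 ≤ γm a (T a) ∧
      γm a (T a) ≤ a ^ 2 * exp (ℓ a) := by
    filter_upwards [hpos, hexpℓ, hΛ.eventually_ge_atTop (2 * log N)] with a ha hexp hbig
    obtain ⟨-, -, h1, h2⟩ := margin_le_neg_log_loss_le hN (hγm a (T a)) (hLf a (T a))
    rw [hLT a ha] at h1 h2
    rw [hexp]
    constructor <;> linarith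
  have hlimi := tendsto_pi_nhds.1 hlim
  refine ⟨fun n => ?_, fun v hv => ?_⟩
  · refine ge_of_tendsto (tendsto_finsetSum _ fun i _ => (hlimi i).const_mul (x n i)) ?_
    filter_upwards [hpos, hγ] with a ha hγ
    have hγ0 : 0 < γm a (T a) := lt_of_lt_of_le (by positivity) hγ.1
    simp only [← mul_div_assoc]
    rw [← Finset.sum_div, le_div_iff₀ hγ0, one_mul]
    exact (hγm a (T a)).2 ⟨n, rfl⟩
  refine sum_abs_le_of_asymptotic_certificate x (ρ := ρ) hℓ (hpos.mono fun a ha => hρ a ha)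
    (fun k hk => ?_) (fun i => ?_) hv
  · obtain ⟨γs, hγs, ρ₀, hρ₀, A, hA⟩ := hstab k hk
    have hδ : 0 < ρ₀ - 1 := sub_pos.2 hρ₀
    have hinv : Tendsto (fun a : ℝ => (a ^ 2 * ℓ a)⁻¹) atTop (𝓝 0) :=
      ((tendsto_pow_atTop two_ne_zero).atTop_mul_atTop₀ hℓ).inv_tendsto_atTop
    have hbound : Tendsto (fun a => (8 * γ₂ ^ 2)⁻¹ * |γs a / (a ^ 2 * ℓ a)| +
        exp ((ρ₀ - 1) * log N) / ((ρ₀ - 1) * (8 * γ₂ ^ 2)) * (a ^ 2 * ℓ a)⁻¹) atTop (𝓝 0) := by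
      have h := (hγs.abs.const_mul (8 * γ₂ ^ 2)⁻¹).add
        (hinv.const_mul (exp ((ρ₀ - 1) * log N) / ((ρ₀ - 1) * (8 * γ₂ ^ 2))))
      rwa [abs_zero, mul_zero, mul_zero, add_zero] at h
    refine tendsto_of_tendsto_of_tendsto_of_le_of_le' tendsto_const_nhds hbound ?_ ?_
    · filter_upwards [hpos, hℓ.eventually_gt_atTop 0] with a ha hℓ
      exact div_nonneg (hρ a ha k) hℓ.le
    · filter_upwards [hpos, hℓ.eventually_gt_atTop 0, eventually_ge_atTop A] with a ha hℓ haA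
      have h := hρle a ha k (γs a) (exp ((ρ₀ - 1) * log N)) (ρ₀ - 1) (exp_pos _).le hδ
        fun t ht h1 h2 => residual_le_of_margin_ratio hN (hγm a t) (hLf a t) hρ₀
          (hA a haA t ht h1 (hLT a ha ▸ h2))
      have hmax : max (γs a) 0 ≤ |γs a| := max_le (le_abs_self _) (abs_nonneg _)
      rw [abs_div, abs_of_pos (show 0 < a ^ 2 * ℓ a by positivity), div_le_iff₀ hℓ]
      refine h.trans ?_
      calc _ ≤ |γs a| / (8 * a ^ 2 * γ₂ ^ 2) +
            exp ((ρ₀ - 1) * log N) / ((ρ₀ - 1) * (8 * a ^ 2 * γ₂ ^ 2)) := by gcongr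
        _ = _ := by field_simp
  · refine eventually_abs_le_and_le_mul (s := fun a => a ^ 2) (γ := fun a => γm a (T a))
      (w := fun a => w a (T a) i) (hpos.mono fun a ha => by positivity) (hℓ.eventually_ge_atTop 0)
      hγ (hpos.mono fun a ha => hwρ a ha i) (hlimi i)
end

section
/- For the linearized (tangent-kernel) model, there exists γ̃★ > 0, independent of α, such that for every α > 0, every t > 0 with γ̄̃(t) ≥ γ̃★, and every index k ∉ S₂, one has x_kᵀ w̄(t) / γ̄(t) ≥ (θ+1)/2 > 1. In particular, the stability condition holds uniformly for the linearized model. -/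
open Real Finset Filter Topology MeasureTheory

lemma mul_exp_neg_le_one (z : ℝ) : z * exp (-z) ≤ 1 := by
  have h := mul_le_mul_of_nonneg_right ((le_add_of_nonneg_right zero_le_one).trans
    (add_one_le_exp z)) (exp_pos (-z)).le
  rwa [← exp_add, add_neg_cancel, exp_zero] at h

lemma mul_exp_neg_sub_one_nonpos (z : ℝ) : z * (exp (-z) - 1) ≤ 0 := by
  rcases le_total 0 z with h | h
  · exact mul_nonpos_of_nonneg_of_nonpos h
      (sub_nonpos.2 (exp_le_one_iff.2 (neg_nonpos.2 h)))
  · exact mul_nonpos_of_nonpos_of_nonneg h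
      (sub_nonneg.2 (one_le_exp (neg_nonneg.2 h)))

section GradientFlow

variable {ι κ : Type*} [Fintype ι] [Fintype κ]

/-- The residual `w - log τ • v - b` of the gradient flow of the exponential loss has almost
nonpositive inner product with its velocity: only the non-support vectors contribute, and their
contribution decays like `τ ^ (-θ)`. -/
lemma residual_dotProduct_velocity_le (x : ι → κ → ℝ) (S : Finset ι) (v b w : κ → ℝ) {θ τ : ℝ}
    (hτ : 1 ≤ τ) (hS : ∀ n ∈ S, x n ⬝ᵥ v = 1) (hSc : ∀ n ∉ S, θ ≤ x n ⬝ᵥ v)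
    (hv : v = ∑ n ∈ S, exp (-(x n ⬝ᵥ b)) • x n) :
    (w - log τ • v - b) ⬝ᵥ (∑ n, exp (-(x n ⬝ᵥ w)) • x n - τ⁻¹ • v) ≤
      (∑ n, exp (-(x n ⬝ᵥ b))) * τ ^ (-θ) := by
  classical
  have hτ0 : 0 < τ := zero_lt_one.trans_le hτ
  set u := w - log τ • v - b with hu
  have hexp (n : ι) : exp (-(x n ⬝ᵥ w)) =
      exp (-(x n ⬝ᵥ b)) * τ ^ (-(x n ⬝ᵥ v)) * exp (-(x n ⬝ᵥ u)) := by
    rw [rpow_def_of_pos hτ0, ← exp_add, ← exp_add, hu]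
    congr 1
    simp only [dotProduct_sub, dotProduct_smul, smul_eq_mul]
    ring
  have hv' : u ⬝ᵥ v = ∑ n, if n ∈ S then exp (-(x n ⬝ᵥ b)) * (x n ⬝ᵥ u) else 0 := by
    rw [Finset.sum_ite_mem, Finset.univ_inter]
    conv_lhs => rw [hv]
    simp only [dotProduct_sum, dotProduct_smul, smul_eq_mul]
    exact Finset.sum_congr rfl fun n _ => by rw [dotProduct_comm u]
  rw [dotProduct_sub, dotProduct_smul, hv', dotProduct_sum, smul_eq_mul, Finset.mul_sum,
    ← Finset.sum_sub_distrib, Finset.sum_mul]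
  refine Finset.sum_le_sum fun n _ => ?_
  rw [dotProduct_smul, smul_eq_mul, dotProduct_comm u, hexp n]
  split_ifs with hn
  · have h := mul_nonpos_of_nonneg_of_nonpos
      (mul_nonneg (exp_pos (-(x n ⬝ᵥ b))).le (inv_nonneg.2 hτ0.le))
      (mul_exp_neg_sub_one_nonpos (x n ⬝ᵥ u))
    rw [hS n hn, rpow_neg_one]
    refine le_trans (le_of_eq ?_) (h.trans (by positivity))
    ring
  · have h := mul_le_mul_of_nonneg_left (mul_exp_neg_le_one (x n ⬝ᵥ u))
      (mul_pos (exp_pos (-(x n ⬝ᵥ b))) (rpow_pos_of_pos hτ0 (-(x n ⬝ᵥ v)))).le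
    have h' := mul_le_mul_of_nonneg_left
      (rpow_le_rpow_of_exponent_le hτ (neg_le_neg (hSc n hn))) (exp_pos (-(x n ⬝ᵥ b))).le
    linarith

/-- The residual of the gradient flow of the exponential loss is bounded, uniformly in time and
in the speed `c` of the flow. -/
lemma residual_dotProduct_self_le (x : ι → κ → ℝ) (S : Finset ι) (v b : κ → ℝ) {θ c : ℝ}
    (hθ : 1 < θ) (hc : 0 ≤ c) (hS : ∀ n ∈ S, x n ⬝ᵥ v = 1) (hSc : ∀ n ∉ S, θ ≤ x n ⬝ᵥ v)
    (hv : v = ∑ n ∈ S, exp (-(x n ⬝ᵥ b)) • x n) (w : ℝ → κ → ℝ) (hw0 : w 0 = 0)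
    (hw : ∀ t, 0 ≤ t → HasDerivAt w (c • ∑ n, exp (-(x n ⬝ᵥ w t)) • x n) t)
    {t : ℝ} (ht : 0 ≤ t) :
    (w t - log (1 + c * t) • v - b) ⬝ᵥ (w t - log (1 + c * t) • v - b) ≤
      b ⬝ᵥ b + 2 * (∑ n, exp (-(x n ⬝ᵥ b))) / (θ - 1) := by
  set K := ∑ n, exp (-(x n ⬝ᵥ b))
  have hK0 : 0 ≤ K := Finset.sum_nonneg fun n _ => (exp_pos _).le
  have hθ' : 0 < θ - 1 := sub_pos.2 hθ
  let u : ℝ → κ → ℝ := fun s => w s - log (1 + c * s) • v - b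
  let F : ℝ → ℝ := fun s => u s ⬝ᵥ u s + 2 * K / (θ - 1) * (1 + c * s) ^ (1 - θ)
  have hτ {s : ℝ} (hs : 0 ≤ s) : 1 ≤ 1 + c * s := le_add_of_nonneg_right (mul_nonneg hc hs)
  have hderiv (s : ℝ) (hs : 0 ≤ s) : HasDerivAt F
      (2 * c * (u s ⬝ᵥ (∑ n, exp (-(x n ⬝ᵥ w s)) • x n - (1 + c * s)⁻¹ • v) -
        K * (1 + c * s) ^ (-θ))) s := by
    have hτ0 : 0 < 1 + c * s := zero_lt_one.trans_le (hτ hs)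
    have hτd : HasDerivAt (fun s : ℝ => 1 + c * s) c s := by
      simpa using ((hasDerivAt_id s).const_mul c).const_add 1
    have hu : HasDerivAt u
        (c • (∑ n, exp (-(x n ⬝ᵥ w s)) • x n - (1 + c * s)⁻¹ • v)) s := by
      refine (((hw s hs).sub ((hτd.log hτ0.ne').smul_const v)).sub_const b).congr_deriv ?_
      rw [smul_sub, smul_smul, div_eq_mul_inv]
    have huu : HasDerivAt (fun s => u s ⬝ᵥ u s) (2 * (u s ⬝ᵥ
        (c • (∑ n, exp (-(x n ⬝ᵥ w s)) • x n - (1 + c * s)⁻¹ • v)))) s := by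
      have h := HasDerivAt.fun_sum (u := Finset.univ) fun i _ =>
        (hasDerivAt_pi.1 hu i).mul (hasDerivAt_pi.1 hu i)
      refine h.congr_deriv ?_
      rw [dotProduct, Finset.mul_sum]
      exact Finset.sum_congr rfl fun i _ => by ring
    refine (huu.add ((hτd.rpow_const (p := 1 - θ) (Or.inl hτ0.ne')).const_mul
      (2 * K / (θ - 1)))).congr_deriv ?_
    rw [dotProduct_smul, smul_eq_mul, show 1 - θ - 1 = -θ by ring]
    field_simp
    ring
  have hanti : AntitoneOn F (Set.Ici 0) := by
    refine antitoneOn_of_deriv_nonpos (convex_Ici 0)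
      (fun s hs => (hderiv s hs).continuousAt.continuousWithinAt)
      (fun s hs => (hderiv s (interior_subset hs)).differentiableAt.differentiableWithinAt)
      fun s hs => ?_
    have hs0 : 0 ≤ s := interior_subset hs
    rw [(hderiv s hs0).deriv]
    exact mul_nonpos_of_nonneg_of_nonpos (by positivity) (sub_nonpos.2
      (residual_dotProduct_velocity_le x S v b (w s) (hτ hs0) hS hSc hv))
  have hF0 : F 0 = b ⬝ᵥ b + 2 * K / (θ - 1) := by
    simp [F, u, hw0]
  have hpos : 0 ≤ 2 * K / (θ - 1) * (1 + c * t) ^ (1 - θ) :=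
    mul_nonneg (by positivity) (rpow_nonneg (zero_le_one.trans (hτ ht)) _)
  calc u t ⬝ᵥ u t ≤ F t := le_add_of_nonneg_right hpos
    _ ≤ F 0 := hanti Set.self_mem_Ici ht ht
    _ = _ := hF0

lemma abs_dotProduct_le_add (p q : κ → ℝ) : |p ⬝ᵥ q| ≤ p ⬝ᵥ p + q ⬝ᵥ q := by
  simp only [dotProduct, ← Finset.sum_add_distrib]
  refine (Finset.abs_sum_le_sum_abs _ _).trans (Finset.sum_le_sum fun i _ => ?_)
  rw [abs_le]
  constructor <;> nlinarith [sq_nonneg (p i + q i), sq_nonneg (p i - q i), sq_nonneg (p i),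
    sq_nonneg (q i)]

/-- Along the gradient flow of the exponential loss, every margin `x n ⬝ᵥ w t` stays within a
bounded distance of `log (1 + c * t) * (x n ⬝ᵥ v)`, uniformly in time and in the speed `c`. -/
lemma exists_abs_margin_sub_le (x : ι → κ → ℝ) (S : Finset ι) (v b : κ → ℝ) {θ : ℝ}
    (hθ : 1 < θ) (hS : ∀ n ∈ S, x n ⬝ᵥ v = 1) (hSc : ∀ n ∉ S, θ ≤ x n ⬝ᵥ v)
    (hv : v = ∑ n ∈ S, exp (-(x n ⬝ᵥ b)) • x n) :
    ∃ M, 0 < M ∧ ∀ c : ℝ, 0 ≤ c → ∀ w : ℝ → κ → ℝ, w 0 = 0 →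
      (∀ t, 0 ≤ t → HasDerivAt w (c • ∑ n, exp (-(x n ⬝ᵥ w t)) • x n) t) →
      ∀ t, 0 ≤ t → ∀ n, |x n ⬝ᵥ w t - log (1 + c * t) * (x n ⬝ᵥ v)| ≤ M := by
  set B := b ⬝ᵥ b + 2 * (∑ n, exp (-(x n ⬝ᵥ b))) / (θ - 1)
  have hself (p : κ → ℝ) : 0 ≤ p ⬝ᵥ p := Finset.sum_nonneg fun i _ => mul_self_nonneg (p i)
  have hB0 : 0 ≤ B := add_nonneg (hself b) (div_nonneg
    (mul_nonneg zero_le_two (Finset.sum_nonneg fun n _ => (exp_pos _).le)) (sub_pos.2 hθ).le)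
  have hterm (n : ι) : 0 ≤ |x n ⬝ᵥ b| + x n ⬝ᵥ x n := add_nonneg (abs_nonneg _) (hself _)
  refine ⟨∑ n, (|x n ⬝ᵥ b| + x n ⬝ᵥ x n) + B + 1, ?_, fun c hc w hw0 hw t ht n => ?_⟩
  · have := Finset.sum_nonneg fun n (_ : n ∈ Finset.univ) => hterm n
    linarith
  · have hu := residual_dotProduct_self_le x S v b hθ hc hS hSc hv w hw0 hw ht
    have hn := Finset.single_le_sum (fun m _ => hterm m) (Finset.mem_univ n)
    have hcs := abs_dotProduct_le_add (x n) (w t - log (1 + c * t) • v - b)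
    have hsplit : x n ⬝ᵥ w t - log (1 + c * t) * (x n ⬝ᵥ v) =
        x n ⬝ᵥ b + x n ⬝ᵥ (w t - log (1 + c * t) • v - b) := by
      simp only [dotProduct_sub, dotProduct_smul, smul_eq_mul]
      ring
    rw [hsplit]
    have := abs_add_le (x n ⬝ᵥ b) (x n ⬝ᵥ (w t - log (1 + c * t) • v - b))
    linarith

end GradientFlow

theorem stmt13
    (d N D : ℕ) (hd : 0 < d) (hN : 0 < N) (hD : 2 ≤ D)
    (x : Fin N → Fin d → ℝ)
    (γ₂ : ℝ) (hγ₂pos : 0 < γ₂)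
    (hγ₂ : IsGreatest {g : ℝ | ∃ v : Fin d → ℝ, (∑ i, (v i)^2) = 1 ∧ ∀ n, g ≤ ∑ i, x n i * v i} γ₂)
    (wb : ℝ → ℝ → Fin d → ℝ)
    (hwb0 : ∀ a : ℝ, 0 < a → ∀ i, wb a 0 i = 0)
    (hflow : ∀ a : ℝ, 0 < a → ∀ t, 0 ≤ t → ∀ i, HasDerivAt (fun s => wb a s i)
        ((2/(N:ℝ)) * (D:ℝ)^2 * a^(2*D-2) * ∑ n, Real.exp (-(∑ j, x n j * wb a t j)) * x n i) t)
    (γb : ℝ → ℝ → ℝ)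
    (hγb : ∀ a t, IsLeast {g : ℝ | ∃ n : Fin N, g = ∑ i, x n i * wb a t i} (γb a t))
    (wl2 : Fin d → ℝ)
    (hwl2feas : ∀ n, 1 ≤ ∑ i, x n i * wl2 i)
    (hwl2min : ∀ v : Fin d → ℝ, (∀ n, 1 ≤ ∑ i, x n i * v i) → v ≠ wl2 →
        (∑ i, (wl2 i)^2) < ∑ i, (v i)^2)
    (ν : Fin N → ℝ)
    (hνpos : ∀ n, (∑ i, x n i * wl2 i) = 1 → 0 < ν n)
    (hrep : ∀ i, wl2 i = ∑ n, (if (∑ j, x n j * wl2 j) = 1 then ν n * x n i else 0))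
    (θ : ℝ) (hθ : 1 < θ)
    (hθdef : IsLeast {g : ℝ | ∃ n : Fin N, (∑ i, x n i * wl2 i) ≠ 1 ∧ g = ∑ i, x n i * wl2 i} θ)
    (wt : Fin d → ℝ)
    (hwt : ∀ n, (∑ i, x n i * wl2 i) = 1 → Real.exp (-(∑ i, x n i * wt i)) = ν n)
    :
    ∃ γs : ℝ, 0 < γs ∧
    ∀ a : ℝ, 0 < a → ∀ t : ℝ, 0 < t →
      γs ≤ -Real.log ((1/(N:ℝ)) * ∑ n, Real.exp (-(∑ i, x n i * wb a t i))) →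
      ∀ k : Fin N, (∑ i, x k i * wl2 i) ≠ 1 →
        (θ + 1) / 2 ≤ (∑ i, x k i * wb a t i) / γb a t ∧ 1 < (θ + 1) / 2 := by
  classical
  let S : Finset (Fin N) := Finset.univ.filter fun n => x n ⬝ᵥ wl2 = 1
  have hmem (n : Fin N) : n ∈ S ↔ x n ⬝ᵥ wl2 = 1 := by simp [S]
  have hSc : ∀ n ∉ S, θ ≤ x n ⬝ᵥ wl2 := fun n hn =>
    hθdef.2 ⟨n, fun h => hn ((hmem n).2 h), rfl⟩
  have hv : wl2 = ∑ n ∈ S, exp (-(x n ⬝ᵥ wt)) • x n := by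
    ext i
    rw [hrep i, Finset.sum_apply, Finset.sum_filter]
    refine Finset.sum_congr rfl fun n _ => ?_
    change (if x n ⬝ᵥ wl2 = 1 then _ else _) = _
    split_ifs with h
    · rw [← hwt n h]
      rfl
    · rfl
  obtain ⟨m, hm⟩ : S.Nonempty := by
    rw [Finset.nonempty_iff_ne_empty]
    intro h
    rw [h, Finset.sum_empty] at hv
    have := hwl2feas ⟨0, hN⟩
    simp only [hv, Pi.zero_apply, mul_zero, Finset.sum_const_zero] at this
    linarith
  obtain ⟨M, hM, hbound⟩ := exists_abs_margin_sub_le x S wl2 wt hθ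
    (fun n hn => (hmem n).1 hn) hSc hv
  have hθ' : 0 < θ - 1 := sub_pos.2 hθ
  have hN1 : (1 : ℝ) ≤ N := by exact_mod_cast hN
  have hN0 : (0 : ℝ) < N := zero_lt_one.trans_le hN1
  have hlogN := log_nonneg hN1
  refine ⟨log N + 2 * M + M * (θ + 3) / (θ - 1), by positivity,
    fun a ha t ht hγs k hk => ⟨?_, by linarith⟩⟩
  set c : ℝ := (2 / (N : ℝ)) * (D : ℝ) ^ 2 * a ^ (2 * D - 2)
  have hflow' (s : ℝ) (hs : 0 ≤ s) :
      HasDerivAt (wb a) (c • ∑ n, exp (-(x n ⬝ᵥ wb a s)) • x n) s := by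
    refine hasDerivAt_pi.2 fun i => (hflow a ha s hs i).congr_deriv ?_
    simp only [Pi.smul_apply, Finset.sum_apply, smul_eq_mul]
    rfl
  have hb := hbound c (by positivity) (wb a) (funext (hwb0 a ha)) hflow' t ht.le
  set l := log (1 + c * t)
  have hmargin : x m ⬝ᵥ wb a t ≤ l + M := by
    have := (abs_le.1 (hb m)).2
    rw [(hmem m).1 hm] at this
    linarith
  have hloss : -log ((1 / (N : ℝ)) * ∑ n, exp (-(x n ⬝ᵥ wb a t))) ≤ log N + x m ⬝ᵥ wb a t := by
    have hle : (1 / (N : ℝ)) * exp (-(x m ⬝ᵥ wb a t)) ≤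
        (1 / (N : ℝ)) * ∑ n, exp (-(x n ⬝ᵥ wb a t)) :=
      mul_le_mul_of_nonneg_left (Finset.single_le_sum
        (f := fun n => exp (-(x n ⬝ᵥ wb a t))) (fun n _ => (exp_pos _).le)
        (Finset.mem_univ m)) (by positivity)
    have := log_le_log (by positivity) hle
    rw [log_mul (by positivity) (exp_pos _).ne', log_exp, one_div, log_inv] at this
    rw [one_div]
    linarith
  have hl_ge : M + M * (θ + 3) / (θ - 1) ≤ l := by
    have := hγs.trans hloss
    linarith
  have hquot : 0 < M * (θ + 3) / (θ - 1) := by positivity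
  obtain ⟨⟨j, hj⟩, hmin⟩ := hγb a t
  have hγ_le : γb a t ≤ l + M := (hmin ⟨m, rfl⟩).trans hmargin
  have hγ_pos : 0 < γb a t := by
    have h1 := (abs_le.1 (hb j)).1
    have h2 : l ≤ l * (x j ⬝ᵥ wl2) := le_mul_of_one_le_right (by linarith) (hwl2feas j)
    have h3 : γb a t = x j ⬝ᵥ wb a t := hj
    linarith
  have hk_ge : l * θ - M ≤ x k ⬝ᵥ wb a t := by
    have h1 := (abs_le.1 (hb k)).1
    have h2 := mul_le_mul_of_nonneg_left (hSc k fun h => hk ((hmem k).1 h))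
      (show 0 ≤ l by linarith)
    linarith
  rw [le_div_iff₀ hγ_pos]
  have h4 := (div_le_iff₀ hθ').1 (show M * (θ + 3) / (θ - 1) ≤ l by linarith)
  have h5 := mul_le_mul_of_nonneg_left hγ_le (show 0 ≤ (θ + 1) / 2 by linarith)
  refine h5.trans (le_trans ?_ hk_ge)
  linarith
end

section
/- For D > 2, along the gradient-flow trajectory every coordinate of u(t) remains nonnegative for all t ≥ 0, and consequently every coordinate of (α^{D−2} D(D−2)/N) · X̃ ∫₀ᵗ exp(−X̃ᵀ u(s)^D) ds lies in [−1, 1], where X̃ ∈ ℝ^{2d×N} is the augmented data matrix whose n-th column is (x_n, −x_n) and the exponential and D-th power are applied coordinatewise. -/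
open Real Finset Filter Topology MeasureTheory

/-- A solution of the linear equation `u' = a u` on `[0, ∞)` that starts positive stays positive. -/
theorem pos_of_hasDerivAt_eq_mul {u a : ℝ → ℝ} (ha : Continuous a) (h0 : 0 < u 0)
    (hu : ∀ t, 0 ≤ t → HasDerivAt u (a t * u t) t) {t : ℝ} (ht : 0 ≤ t) : 0 < u t := by
  have hA : ∀ s, HasDerivAt (fun s => ∫ r in (0:ℝ)..s, a r) (a s) s := fun s =>
    intervalIntegral.integral_hasDerivAt_right (ha.intervalIntegrable _ _)
      (ha.stronglyMeasurableAtFilter _ _) ha.continuousAt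
  have hF : ∀ s, 0 ≤ s →
      HasDerivAt (fun s => u s * Real.exp (-∫ r in (0:ℝ)..s, a r)) 0 s := fun s hs =>
    ((hu s hs).mul (hA s).neg.exp).congr_deriv (by ring)
  have hconst := constant_of_has_deriv_right_zero
    (fun s hs => (hF s hs.1).continuousAt.continuousWithinAt)
    (fun s hs => (hF s hs.1).hasDerivWithinAt) t ⟨ht, le_rfl⟩
  simp only [intervalIntegral.integral_same, neg_zero, Real.exp_zero, mul_one] at hconst
  exact pos_of_mul_pos_left (hconst ▸ h0) (Real.exp_pos _).le

/-- A solution of `u' = c u ^ (k + 2)` on `[0, ∞)` that starts positive stays positive, and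
positivity of `u ^ (-(k + 1))` bounds the integral of `c`. -/
theorem pos_and_integral_le_of_hasDerivAt_eq_mul_pow {u c : ℝ → ℝ} {k : ℕ} (hc : Continuous c)
    (h0 : 0 < u 0) (hu : ∀ t, 0 ≤ t → HasDerivAt u (c t * u t ^ (k + 2)) t)
    {t : ℝ} (ht : 0 ≤ t) :
    0 < u t ∧ u 0 ^ (k + 1) * ((k : ℝ) + 1) * ∫ s in (0:ℝ)..t, c s ≤ 1 := by
  have hcont : Continuous fun s => u (max s 0) := continuous_iff_continuousAt.2 fun s =>
    ContinuousAt.comp (f := fun s : ℝ => max s 0) (hu _ (le_max_right s 0)).continuousAt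
      (by fun_prop)
  have hpos : ∀ s, 0 ≤ s → 0 < u s := fun s hs =>
    pos_of_hasDerivAt_eq_mul (a := fun s => c s * u (max s 0) ^ (k + 1))
      (hc.mul (hcont.pow _)) h0
      (fun r hr => (hu r hr).congr_deriv (by simp only [max_eq_left hr]; ring)) hs
  refine ⟨hpos t ht, ?_⟩
  have hC : ∀ s, HasDerivAt (fun s => ∫ r in (0:ℝ)..s, c r) (c s) s := fun s =>
    intervalIntegral.integral_hasDerivAt_right (hc.intervalIntegrable _ _)
      (hc.stronglyMeasurableAtFilter _ _) hc.continuousAt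
  have hF : ∀ s, 0 ≤ s → HasDerivAt
      (fun s => (u s ^ (k + 1))⁻¹ + ((k : ℝ) + 1) * ∫ r in (0:ℝ)..s, c r) 0 s := by
    intro s hs
    have hne := (hpos s hs).ne'
    refine ((((hu s hs).fun_pow (k + 1)).fun_inv (pow_ne_zero _ hne)).add
      ((hC s).const_mul ((k : ℝ) + 1))).congr_deriv ?_
    simp only [Nat.add_sub_cancel]
    push_cast
    field_simp
    ring
  have hconst := constant_of_has_deriv_right_zero
    (fun s hs => (hF s hs.1).continuousAt.continuousWithinAt)
    (fun s hs => (hF s hs.1).hasDerivWithinAt) t ⟨ht, le_rfl⟩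
  simp only [intervalIntegral.integral_same, mul_zero, add_zero] at hconst
  have h1 : ((k : ℝ) + 1) * ∫ r in (0:ℝ)..t, c r ≤ (u 0 ^ (k + 1))⁻¹ := by
    have := inv_pos.2 (pow_pos (hpos t ht) (k + 1))
    linarith
  have h2 := pow_pos h0 (k + 1)
  calc u 0 ^ (k + 1) * ((k : ℝ) + 1) * ∫ s in (0:ℝ)..t, c s
      = u 0 ^ (k + 1) * (((k : ℝ) + 1) * ∫ s in (0:ℝ)..t, c s) := by ring
    _ ≤ u 0 ^ (k + 1) * (u 0 ^ (k + 1))⁻¹ := by gcongr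
    _ = 1 := mul_inv_cancel₀ h2.ne'

open Real Finset Filter Topology MeasureTheory

theorem stmt16
    (d N D : ℕ) (hd : 0 < d) (hN : 0 < N) (hD : 2 < D)
    (x : Fin N → Fin d → ℝ)
    (γ₂ : ℝ) (hγ₂pos : 0 < γ₂)
    (hγ₂ : IsGreatest {g : ℝ | ∃ v : Fin d → ℝ, (∑ i, (v i)^2) = 1 ∧ ∀ n, g ≤ ∑ i, x n i * v i} γ₂)
    (α : ℝ) (hα : 0 < α)
    (up um : ℝ → Fin d → ℝ)
    (hinit : ∀ i, up 0 i = α ∧ um 0 i = α)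
    (w : ℝ → Fin d → ℝ)
    (hw : ∀ t i, w t i = (up t i)^D - (um t i)^D)
    (hflowp : ∀ t, 0 ≤ t → ∀ i, HasDerivAt (fun s => up s i)
        (((D:ℝ)/(N:ℝ)) * (up t i)^(D-1) * ∑ n, Real.exp (-(∑ j, x n j * w t j)) * x n i) t)
    (hflowm : ∀ t, 0 ≤ t → ∀ i, HasDerivAt (fun s => um s i)
        (-(((D:ℝ)/(N:ℝ)) * (um t i)^(D-1) * ∑ n, Real.exp (-(∑ j, x n j * w t j)) * x n i)) t)
    :
    ∀ t : ℝ, 0 ≤ t →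
      (∀ i : Fin d, 0 ≤ up t i ∧ 0 ≤ um t i) ∧
      ∀ i : Fin d,
        |α^(D-2) * (D:ℝ) * ((D:ℝ)-2) / (N:ℝ) *
          ∑ n, x n i * ∫ s in (0:ℝ)..t, Real.exp (-(∑ j, x n j * w s j))| ≤ 1 := by
  intro t ht
  obtain ⟨k, rfl⟩ : ∃ k, D = k + 3 := ⟨D - 3, by omega⟩
  let e : Fin N → ℝ → ℝ := fun n s => Real.exp (-(∑ j, x n j * w (max s 0) j))
  have hmax : ∀ s, 0 ≤ s → ∀ n, e n s = Real.exp (-(∑ j, x n j * w s j)) := by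
    intro s hs n
    simp only [e, max_eq_left hs]
  have he : ∀ n, Continuous (e n) := by
    intro n
    refine Real.continuous_exp.comp (continuous_finsetSum _ fun j _ => ?_).neg
    simp only [hw]
    refine continuous_const.mul (Continuous.sub (Continuous.pow ?_ _) (Continuous.pow ?_ _)) <;>
      refine continuous_iff_continuousAt.2 fun s => ?_
    · exact ContinuousAt.comp (f := fun s : ℝ => max s 0)
        (hflowp _ (le_max_right s 0) j).continuousAt (by fun_prop)
    · exact ContinuousAt.comp (f := fun s : ℝ => max s 0)
        (hflowm _ (le_max_right s 0) j).continuousAt (by fun_prop)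
  let c : Fin d → ℝ → ℝ := fun i s => (((k + 3 : ℕ) : ℝ) / (N : ℝ)) * ∑ n, e n s * x n i
  have hc : ∀ i, Continuous (c i) := fun i =>
    continuous_const.mul (continuous_finsetSum _ fun n _ => (he n).mul continuous_const)
  have hp : ∀ i, 0 < up t i ∧ _ := fun i =>
    pos_and_integral_le_of_hasDerivAt_eq_mul_pow (u := fun s => up s i) (k := k) (hc i)
      (by simp only [(hinit i).1, hα])
      (fun s hs => (hflowp s hs i).congr_deriv (by simp only [c, hmax s hs, Nat.reduceSubDiff]; ring)) ht
  have hm : ∀ i, 0 < um t i ∧ _ := fun i =>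
    pos_and_integral_le_of_hasDerivAt_eq_mul_pow (u := fun s => um s i) (k := k) (hc i).neg
      (by simp only [(hinit i).2, hα])
      (fun s hs => (hflowm s hs i).congr_deriv (by simp only [c, Pi.neg_apply, hmax s hs, Nat.reduceSubDiff]; ring)) ht
  refine ⟨fun i => ⟨(hp i).1.le, (hm i).1.le⟩, fun i => ?_⟩
  have hint : ∫ s in (0:ℝ)..t, c i s = (((k + 3 : ℕ) : ℝ) / (N : ℝ)) *
      ∑ n, x n i * ∫ s in (0:ℝ)..t, Real.exp (-(∑ j, x n j * w s j)) := by
    simp only [c]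
    rw [intervalIntegral.integral_const_mul, intervalIntegral.integral_finsetSum
      (f := fun n s => e n s * x n i)
      fun n _ => ((he n).mul continuous_const).intervalIntegrable _ _]
    congr 1
    refine Finset.sum_congr rfl fun n _ => ?_
    rw [intervalIntegral.integral_mul_const, mul_comm]
    congr 1
    refine intervalIntegral.integral_congr fun s hs => hmax s ?_ n
    rw [Set.uIcc_of_le ht] at hs
    exact hs.1
  have h1 := (hp i).2
  have h2 := (hm i).2
  simp only [Pi.neg_apply, intervalIntegral.integral_neg, (hinit i).1, (hinit i).2, hint] at h1 h2
  have hexp : k + 3 - 2 = k + 1 := by omega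
  rw [hexp, abs_le]
  push_cast at h1 h2 ⊢
  constructor
  · refine neg_le.1 (le_of_eq_of_le ?_ h2)
    ring
  · refine le_of_eq_of_le ?_ h1
    ring
end

section
/- For D = 2 and every t ≥ 0, the gradient-flow trajectory satisfies ‖w(t)‖₂ ≤ (x_max/γ₂²) · [ (2α²γ₂²/x̄) · sinh( (x̄/(2α²γ₂²)) γ̃(t) ) − γ̃(t) ] + 8α² ∫₀ᵗ ‖X r(τ)‖₂ dτ. -/
open Real Finset Filter Topology MeasureTheory

theorem le_initial_of_hasDerivAt_nonpos {f f' : ℝ → ℝ}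
    (h : ∀ t, 0 ≤ t → HasDerivAt f (f' t) t) (h' : ∀ t, 0 ≤ t → f' t ≤ 0)
    {t : ℝ} (ht : 0 ≤ t) : f t ≤ f 0 := by
  have hanti : AntitoneOn f (Set.Ici 0) := by
    refine antitoneOn_of_deriv_nonpos (convex_Ici 0)
      (fun s hs => (h s hs).continuousAt.continuousWithinAt) ?_ ?_
    · intro s hs
      exact (h s (interior_subset hs)).differentiableAt.differentiableWithinAt
    · intro s hs
      rw [(h s (interior_subset hs)).deriv]
      exact h' s (interior_subset hs)
  exact hanti Set.self_mem_Ici ht ht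

/-- Grönwall's inequality for a nonnegative function with a logarithmic growth rate `p` dominated
by the derivative of `g`. -/
theorem le_initial_mul_exp_of_hasDerivAt {a p g g' : ℝ → ℝ}
    (ha : ∀ t, 0 ≤ t → HasDerivAt a (p t * a t) t)
    (hg : ∀ t, 0 ≤ t → HasDerivAt g (g' t) t) (hg0 : g 0 = 0)
    (ha0 : ∀ t, 0 ≤ a t) (hpg : ∀ t, 0 ≤ t → p t ≤ g' t)
    {t : ℝ} (ht : 0 ≤ t) : a t ≤ a 0 * Real.exp (g t) := by
  have key := le_initial_of_hasDerivAt_nonpos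
    (f := fun s => a s * Real.exp (-g s))
    (fun s hs => (ha s hs).mul (hg s hs).fun_neg.exp) (fun s hs => by
      have h1 : 0 ≤ (g' s - p s) * (a s * Real.exp (-g s)) :=
        mul_nonneg (sub_nonneg.2 (hpg s hs)) (mul_nonneg (ha0 s) (Real.exp_pos _).le)
      nlinarith) ht
  simp only [hg0, neg_zero, Real.exp_zero, mul_one] at key
  rw [Real.exp_neg, ← div_eq_mul_inv, div_le_iff₀ (Real.exp_pos _)] at key
  exact key

theorem add_le_two_mul_cosh {a b c y : ℝ} (hc : 0 < c) (hab : a * b = c ^ 2)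
    (ha : a ≤ c * Real.exp y) (hb : b ≤ c * Real.exp y) :
    a + b ≤ 2 * c * Real.cosh y := by
  have h := mul_nonneg (sub_nonneg.2 ha) (sub_nonneg.2 hb)
  have he : Real.exp y * Real.exp (-y) = 1 := by rw [← Real.exp_add]; simp
  rw [Real.cosh_eq]
  have hp : 0 < c * Real.exp y := mul_pos hc (Real.exp_pos y)
  refine le_of_mul_le_mul_left ?_ hp
  have e : c * Real.exp y * (2 * c * ((Real.exp y + Real.exp (-y)) / 2))
      = (c * Real.exp y) ^ 2 + c ^ 2 := by linear_combination c ^ 2 * he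
  rw [e]
  nlinarith

theorem two_mul_le_add_of_mul_eq_sq {a b c : ℝ} (ha : 0 ≤ a) (hb : 0 ≤ b)
    (hab : a * b = c ^ 2) : 2 * c ≤ a + b := by
  refine (abs_le_of_sq_le_sq' ?_ (add_nonneg ha hb)).2
  nlinarith [sq_nonneg (a - b)]

theorem sqrt_sum_sq_le_const_mul {ι : Type*} [Fintype ι] {f g : ι → ℝ} {C : ℝ} (hC : 0 ≤ C)
    (h : ∀ i, |f i| ≤ C * |g i|) :
    Real.sqrt (∑ i, f i ^ 2) ≤ C * Real.sqrt (∑ i, g i ^ 2) := by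
  rw [← Real.sqrt_sq hC, ← Real.sqrt_mul (sq_nonneg C), Finset.mul_sum]
  refine Real.sqrt_le_sqrt (Finset.sum_le_sum fun i _ => ?_)
  rw [← mul_pow, sq_le_sq, abs_mul, abs_of_nonneg hC]
  exact h i

theorem sqrt_sum_sq_le_of_hasDerivAt {ι : Type*} [Fintype ι] {w w' : ℝ → ι → ℝ} {B B' : ℝ → ℝ}
    (hw : ∀ t, 0 ≤ t → ∀ i, HasDerivAt (fun s => w s i) (w' t i) t)
    (hB : ∀ t, 0 ≤ t → HasDerivAt B (B' t) t)
    (hw0 : ∀ i, w 0 i = 0) (hB0 : 0 ≤ B 0)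
    (hle : ∀ t, 0 ≤ t → Real.sqrt (∑ i, w' t i ^ 2) ≤ B' t) {t : ℝ} (ht : 0 ≤ t) :
    Real.sqrt (∑ i, w t i ^ 2) ≤ B t := by
  have hd : ∀ s, 0 ≤ s →
      HasDerivAt (fun s => WithLp.toLp 2 (w s)) (WithLp.toLp 2 (w' s)) s := fun s hs =>
    (PiLp.hasFDerivAt_toLp 2 (w s)).comp_hasDerivAt s (hasDerivAt_pi.2 (hw s hs))
  have hn : ∀ v : ι → ℝ, ‖(WithLp.toLp 2 v : EuclideanSpace ℝ ι)‖ = Real.sqrt (∑ i, v i ^ 2) := by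
    intro v
    simp [EuclideanSpace.norm_eq]
  have key := image_norm_le_of_norm_deriv_right_le_deriv_boundary' (a := 0) (b := t)
    (f := fun s => (WithLp.toLp 2 (w s) : EuclideanSpace ℝ ι))
    (f' := fun s => WithLp.toLp 2 (w' s)) (B := B) (B' := B')
    (fun s hs => (hd s hs.1).continuousAt.continuousWithinAt)
    (fun s hs => (hd s hs.1).hasDerivWithinAt)
    (by rw [hn]; simpa [hw0] using hB0)
    (fun s hs => (hB s hs.1).continuousAt.continuousWithinAt)
    (fun s hs => (hB s hs.1).hasDerivWithinAt)
    (fun s hs => by rw [hn]; exact hle s hs.1)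
    (Set.right_mem_Icc.2 ht)
  rwa [hn] at key

theorem stmt17
    (d N D : ℕ) (hd : 0 < d) (hN : 0 < N) (hD : 2 ≤ D) (hD2 : D = 2)
    (x : Fin N → Fin d → ℝ)
    (γ₂ : ℝ) (hγ₂pos : 0 < γ₂)
    (hγ₂ : IsGreatest {g : ℝ | ∃ v : Fin d → ℝ, (∑ i, (v i)^2) = 1 ∧ ∀ n, g ≤ ∑ i, x n i * v i} γ₂)
    (α : ℝ) (hα : 0 < α)
    (up um : ℝ → Fin d → ℝ)
    (hinit : ∀ i, up 0 i = α ∧ um 0 i = α)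
    (w : ℝ → Fin d → ℝ)
    (hw : ∀ t i, w t i = (up t i)^D - (um t i)^D)
    (hflowp : ∀ t, 0 ≤ t → ∀ i, HasDerivAt (fun s => up s i)
        (((D:ℝ)/(N:ℝ)) * (up t i)^(D-1) * ∑ n, Real.exp (-(∑ j, x n j * w t j)) * x n i) t)
    (hflowm : ∀ t, 0 ≤ t → ∀ i, HasDerivAt (fun s => um s i)
        (-(((D:ℝ)/(N:ℝ)) * (um t i)^(D-1) * ∑ n, Real.exp (-(∑ j, x n j * w t j)) * x n i)) t)
    (Lf : ℝ → ℝ)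
    (hLf : ∀ t, Lf t = (1 / (N:ℝ)) * ∑ n, Real.exp (-(∑ i, x n i * w t i)))
    (r : ℝ → Fin N → ℝ)
    (hr : ∀ t n, r t n = (1 / (N:ℝ)) * Real.exp (-(∑ i, x n i * w t i)))
    (xbar : ℝ)
    (hxbar : IsGreatest {v : ℝ | ∃ i : Fin d, v = ∑ n, |x n i|} xbar)
    (xmax : ℝ)
    (hxmax : IsGreatest {v : ℝ | ∃ n : Fin N, v = Real.sqrt (∑ i, (x n i)^2)} xmax)
    :
    ∀ t : ℝ, 0 ≤ t →
      Real.sqrt (∑ i, (w t i)^2) ≤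
        (xmax / γ₂^2) * ((2 * α^2 * γ₂^2 / xbar) *
            Real.sinh ((xbar / (2 * α^2 * γ₂^2)) * (-Real.log (Lf t))) - (-Real.log (Lf t)))
        + 8 * α^2 * ∫ τ in (0:ℝ)..t, Real.sqrt (∑ i, (∑ n, r τ n * x n i)^2) := by
  subst hD2
  have hNr : (0 : ℝ) < N := Nat.cast_pos.2 hN
  have hα2 : 0 < α ^ 2 := by positivity
  set q : ℝ → Fin d → ℝ := fun t i => ∑ n, r t n * x n i with hq
  have hrpos : ∀ t n, 0 < r t n := fun t n => by rw [hr]; positivity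
  have hLr : ∀ t, Lf t = ∑ n, r t n := fun t => by
    rw [hLf, Finset.mul_sum]
    exact Finset.sum_congr rfl fun n _ => (hr t n).symm
  have hLpos : ∀ t, 0 < Lf t := fun t => by
    rw [hLr]
    exact Finset.sum_pos (fun n _ => hrpos t n) ⟨⟨0, hN⟩, Finset.mem_univ _⟩
  have hqsum : ∀ t i, (∑ n, Real.exp (-(∑ j, x n j * w t j)) * x n i) = N * q t i := fun t i => by
    rw [hq, Finset.mul_sum]
    refine Finset.sum_congr rfl fun n _ => ?_
    rw [hr]
    field_simp
  have hup : ∀ t, 0 ≤ t → ∀ i, HasDerivAt (fun s => up s i ^ 2) (4 * q t i * up t i ^ 2) t := by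
    intro t ht i
    have h := (hflowp t ht i).pow 2
    refine h.congr_deriv ?_
    rw [hqsum]
    push_cast
    field_simp
    ring
  have hum : ∀ t, 0 ≤ t → ∀ i, HasDerivAt (fun s => um s i ^ 2) (-4 * q t i * um t i ^ 2) t := by
    intro t ht i
    have h := (hflowm t ht i).pow 2
    refine h.congr_deriv ?_
    rw [hqsum]
    push_cast
    field_simp
    ring
  have hprod : ∀ t, 0 ≤ t → ∀ i, up t i ^ 2 * um t i ^ 2 = (α ^ 2) ^ 2 := by
    intro t ht i
    have hd : ∀ s, 0 ≤ s → HasDerivAt (fun s => up s i ^ 2 * um s i ^ 2) 0 s := fun s hs =>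
      ((hup s hs i).mul (hum s hs i)).congr_deriv (by ring)
    have h1 := le_initial_of_hasDerivAt_nonpos hd (fun _ _ => le_rfl) ht
    have h2 := le_initial_of_hasDerivAt_nonpos (fun s hs => (hd s hs).neg)
      (fun _ _ => by simp) ht
    simp only [(hinit i).1, (hinit i).2, Pi.neg_apply] at h1 h2
    linarith
  have hwd : ∀ t, 0 ≤ t → ∀ i,
      HasDerivAt (fun s => w s i) (4 * (up t i ^ 2 + um t i ^ 2) * q t i) t := by
    intro t ht i
    have e : (fun s => w s i) = fun s => up s i ^ 2 - um s i ^ 2 := funext fun s => hw s i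
    rw [e]
    exact ((hup t ht i).sub (hum t ht i)).congr_deriv (by ring)
  have hw0 : ∀ i, w 0 i = 0 := fun i => by simp [hw, (hinit i).1, (hinit i).2]
  have hrd : ∀ t, 0 ≤ t → ∀ n, HasDerivAt (fun s => r s n)
      (-(∑ i, r t n * x n i * (4 * (up t i ^ 2 + um t i ^ 2) * q t i))) t := by
    intro t ht n
    have e : (fun s => r s n) = fun s => (1 / (N : ℝ)) * Real.exp (-(∑ i, x n i * w s i)) :=
      funext fun s => hr s n
    rw [e]
    have h := ((HasDerivAt.fun_sum fun i (_ : i ∈ Finset.univ) =>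
      (hwd t ht i).const_mul (x n i)).fun_neg.exp).const_mul (1 / (N : ℝ))
    refine h.congr_deriv ?_
    rw [← mul_assoc, ← hr t n, mul_neg, Finset.mul_sum]
    simp only [mul_assoc]
  have hLd : ∀ t, 0 ≤ t → HasDerivAt Lf
      (-(∑ i, 4 * (up t i ^ 2 + um t i ^ 2) * q t i ^ 2)) t := by
    intro t ht
    rw [funext hLr]
    refine (HasDerivAt.fun_sum fun n (_ : n ∈ Finset.univ) => hrd t ht n).congr_deriv ?_
    rw [Finset.sum_neg_distrib, Finset.sum_comm]
    congr 1
    refine Finset.sum_congr rfl fun i _ => ?_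
    rw [← Finset.sum_mul]
    ring
  set G : ℝ → ℝ := fun t => -Real.log (Lf t) with hG
  set G' : ℝ → ℝ := fun t => (∑ i, 4 * (up t i ^ 2 + um t i ^ 2) * q t i ^ 2) / Lf t with hG'
  have hGd : ∀ t, 0 ≤ t → HasDerivAt G (G' t) t := fun t ht =>
    ((hLd t ht).log (hLpos t).ne').neg.congr_deriv (by rw [hG', neg_div, neg_neg])
  have hG0 : G 0 = 0 := by
    have : Lf 0 = 1 := by
      rw [hLf]
      simp [hw0, hNr.ne']
    simp [hG, this]
  obtain ⟨⟨v, hv1, hvm⟩, -⟩ := hγ₂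
  have hqnorm : ∀ t, γ₂ * Lf t ≤ Real.sqrt (∑ i, q t i ^ 2) := by
    intro t
    calc γ₂ * Lf t = ∑ n, r t n * γ₂ := by rw [hLr, Finset.mul_sum]; simp only [mul_comm]
      _ ≤ ∑ n, r t n * ∑ i, x n i * v i :=
        Finset.sum_le_sum fun n _ => mul_le_mul_of_nonneg_left (hvm n) (hrpos t n).le
      _ = ∑ i, q t i * v i := by
        simp only [hq, Finset.mul_sum, Finset.sum_mul]
        rw [Finset.sum_comm]
        simp only [mul_assoc]
      _ ≤ Real.sqrt (∑ i, q t i ^ 2) * Real.sqrt (∑ i, v i ^ 2) :=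
        Real.sum_mul_le_sqrt_mul_sqrt _ _ _
      _ = Real.sqrt (∑ i, q t i ^ 2) := by rw [hv1]; simp
  have hγxmax : γ₂ ≤ xmax := by
    refine le_trans ?_ (hxmax.2 ⟨⟨0, hN⟩, rfl⟩)
    calc γ₂ ≤ ∑ i, x ⟨0, hN⟩ i * v i := hvm _
      _ ≤ _ := Real.sum_mul_le_sqrt_mul_sqrt _ _ _
      _ = _ := by rw [hv1]; simp
  have hqabs : ∀ t i, |q t i| ≤ xbar * Lf t := by
    intro t i
    calc |q t i| ≤ ∑ n, |r t n * x n i| := Finset.abs_sum_le_sum_abs _ _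
      _ ≤ ∑ n, Lf t * |x n i| := by
        refine Finset.sum_le_sum fun n _ => ?_
        rw [abs_mul, abs_of_pos (hrpos t n)]
        refine mul_le_mul_of_nonneg_right ?_ (abs_nonneg _)
        rw [hLr]
        exact Finset.single_le_sum (fun m _ => (hrpos t m).le) (Finset.mem_univ n)
      _ = (∑ n, |x n i|) * Lf t := by rw [← Finset.mul_sum, mul_comm]
      _ ≤ xbar * Lf t := mul_le_mul_of_nonneg_right (hxbar.2 ⟨i, rfl⟩) (hLpos t).le
  have hxbarpos : 0 < xbar := by
    by_contra! hneg
    have hq0 : ∀ i, q 0 i = 0 := fun i => abs_eq_zero.1 <| le_antisymm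
      ((hqabs 0 i).trans (mul_nonpos_of_nonpos_of_nonneg hneg (hLpos 0).le)) (abs_nonneg _)
    have h := hqnorm 0
    simp only [hq0] at h
    simp only [ne_eq, OfNat.ofNat_ne_zero, not_false_eq_true, zero_pow, Finset.sum_const_zero,
      Real.sqrt_zero] at h
    exact absurd h (not_le.2 (mul_pos hγ₂pos (hLpos 0)))
  have hG'lower : ∀ t, 0 ≤ t → 8 * α ^ 2 * Real.sqrt (∑ i, q t i ^ 2) ^ 2 / Lf t ≤ G' t := by
    intro t ht
    refine div_le_div_of_nonneg_right ?_ (hLpos t).le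
    rw [Real.sq_sqrt (Finset.sum_nonneg fun i _ => sq_nonneg _), Finset.mul_sum]
    refine Finset.sum_le_sum fun i _ => mul_le_mul_of_nonneg_right ?_ (sq_nonneg _)
    linarith [two_mul_le_add_of_mul_eq_sq (sq_nonneg (up t i)) (sq_nonneg (um t i)) (hprod t ht i)]
  set c : ℝ := xbar / (2 * α ^ 2 * γ₂ ^ 2) with hc
  have hcpos : 0 < c := by positivity
  have hqG : ∀ t, 0 ≤ t → ∀ i, 4 * |q t i| ≤ c * G' t := by
    intro t ht i
    have h1 : 8 * α ^ 2 * γ₂ ^ 2 * Lf t ≤ G' t := by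
      refine le_trans ?_ (hG'lower t ht)
      rw [le_div_iff₀ (hLpos t)]
      have h2 := pow_le_pow_left₀ (mul_pos hγ₂pos (hLpos t)).le (hqnorm t) 2
      nlinarith
    have h2 : c * (8 * α ^ 2 * γ₂ ^ 2 * Lf t) = 4 * (xbar * Lf t) := by
      rw [hc]
      field_simp
      ring
    have h3 := mul_le_mul_of_nonneg_left h1 hcpos.le
    linarith [hqabs t i]
  have hcosh : ∀ t, 0 ≤ t → ∀ i,
      up t i ^ 2 + um t i ^ 2 ≤ 2 * α ^ 2 * Real.cosh (c * G t) := by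
    intro t ht i
    have h1 := le_initial_mul_exp_of_hasDerivAt (fun s hs => hup s hs i)
      (fun s hs => (hGd s hs).const_mul c) (by simp [hG0]) (fun s => sq_nonneg _)
      (fun s hs => by linarith [hqG s hs i, le_abs_self (q s i)]) ht
    have h2 := le_initial_mul_exp_of_hasDerivAt (fun s hs => hum s hs i)
      (fun s hs => (hGd s hs).const_mul c) (by simp [hG0]) (fun s => sq_nonneg _)
      (fun s hs => by linarith [hqG s hs i, neg_abs_le (q s i)]) ht
    rw [(hinit i).1] at h1
    rw [(hinit i).2] at h2
    exact add_le_two_mul_cosh hα2 (hprod t ht i) h1 h2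
  have hqcont : Continuous fun τ => Real.sqrt (∑ i, q (max τ 0) i ^ 2) := by
    have hrc : ∀ n, Continuous fun τ => r (max τ 0) n := fun n =>
      ContinuousOn.comp_continuous (s := Set.Ici 0) (f := fun τ : ℝ => max τ 0)
        (g := fun s => r s n)
        (fun s hs => (hrd s hs n).continuousAt.continuousWithinAt) (by fun_prop)
        (fun τ => le_max_right τ 0)
    simp only [hq]
    exact Real.continuous_sqrt.comp (continuous_finsetSum _ fun i _ =>
      (continuous_finsetSum _ fun n _ => (hrc n).mul continuous_const).pow 2)
  intro t ht
  have hint : ∫ τ in (0 : ℝ)..t, Real.sqrt (∑ i, q τ i ^ 2)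
      = ∫ τ in (0 : ℝ)..t, Real.sqrt (∑ i, q (max τ 0) i ^ 2) := by
    refine intervalIntegral.integral_congr fun τ hτ => ?_
    rw [Set.uIcc_of_le ht] at hτ
    simp only [max_eq_left hτ.1]
  have hcinv : 2 * α ^ 2 * γ₂ ^ 2 / xbar = c⁻¹ := by rw [hc, inv_div]
  change _ ≤ xmax / γ₂ ^ 2 * (2 * α ^ 2 * γ₂ ^ 2 / xbar * Real.sinh (c * G t) - G t)
    + 8 * α ^ 2 * ∫ τ in (0 : ℝ)..t, Real.sqrt (∑ i, q τ i ^ 2)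
  rw [hint, hcinv]
  refine sqrt_sum_sq_le_of_hasDerivAt hwd
    (B := fun t => xmax / γ₂ ^ 2 * (c⁻¹ * Real.sinh (c * G t) - G t)
      + 8 * α ^ 2 * ∫ τ in (0 : ℝ)..t, Real.sqrt (∑ i, q (max τ 0) i ^ 2))
    (fun s hs => ((((((hGd s hs).const_mul c).sinh).const_mul c⁻¹).sub
      (hGd s hs)).const_mul _).add ((hqcont.integral_hasStrictDerivAt 0 s).hasDerivAt.const_mul _))
    hw0 (by simp [hG0]) ?_ ht
  intro s hs
  rw [max_eq_left hs]
  set S := Real.sqrt (∑ i, q s i ^ 2)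
  have hcosh1 := Real.one_le_cosh (c * G s)
  have hnorm : Real.sqrt (∑ i, (4 * (up s i ^ 2 + um s i ^ 2) * q s i) ^ 2)
      ≤ 8 * α ^ 2 * Real.cosh (c * G s) * S := by
    refine sqrt_sum_sq_le_const_mul (by positivity) fun i => ?_
    rw [abs_mul, abs_of_nonneg (by positivity)]
    refine mul_le_mul_of_nonneg_right ?_ (abs_nonneg _)
    linarith [hcosh s hs i]
  have hxmax0 : 0 ≤ xmax := hγ₂pos.le.trans hγxmax
  have hrate : 8 * α ^ 2 * S ≤ xmax / γ₂ ^ 2 * G' s := by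
    have h1 : 8 * α ^ 2 * γ₂ * S ≤ G' s := by
      refine le_trans ?_ (hG'lower s hs)
      rw [le_div_iff₀ (hLpos s)]
      have h2 := mul_le_mul_of_nonneg_left (hqnorm s) (by positivity : 0 ≤ 8 * α ^ 2 * S)
      linarith
    calc 8 * α ^ 2 * S = γ₂ / γ₂ ^ 2 * (8 * α ^ 2 * γ₂ * S) := by field_simp
      _ ≤ xmax / γ₂ ^ 2 * G' s := by gcongr
  have hmul := mul_le_mul_of_nonneg_right hrate (sub_nonneg.2 hcosh1)
  have hcc : c⁻¹ * (Real.cosh (c * G s) * (c * G' s)) = Real.cosh (c * G s) * G' s := by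
    field_simp
  rw [hcc]
  linarith
end

section
/- For D = 2 and every t ≥ 0, the smoothed margin of the gradient-flow trajectory satisfies γ̃(t) ≥ 8 α² γ₂ ∫₀ᵗ ‖X r(τ)‖₂ dτ. -/
open Real Finset Filter Topology MeasureTheory

/-- The conserved product: if `f' = c f` and `g' = -c g` on `[0, ∞)` then `f g` is constant. -/
lemma mul_eq_of_hasDerivAt_opposite_rates {f g c : ℝ → ℝ}
    (hf : ∀ t, 0 ≤ t → HasDerivAt f (c t * f t) t)
    (hg : ∀ t, 0 ≤ t → HasDerivAt g (-(c t * g t)) t) {t : ℝ} (ht : 0 ≤ t) :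
    f t * g t = f 0 * g 0 := by
  have hfg : ∀ s, 0 ≤ s → HasDerivAt (fun s => f s * g s) 0 s := fun s hs =>
    ((hf s hs).mul (hg s hs)).congr_deriv (by ring)
  exact constant_of_has_deriv_right_zero (f := fun s => f s * g s) (a := 0) (b := t)
    (fun s hs => (hfg s hs.1).continuousAt.continuousWithinAt)
    (fun s hs => (hfg s hs.1).hasDerivWithinAt) t ⟨ht, le_rfl⟩

/-- A unit direction of margin `γ` bounds the norm of a nonnegative combination of the data
from below by `γ` times its total weight. -/
lemma margin_mul_sum_le_sqrt {ι κ : Type*} [Fintype ι] [Fintype κ] (x : κ → ι → ℝ) (v : ι → ℝ)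
    (hv : ∑ i, (v i) ^ 2 = 1) {γ : ℝ} (hγ : ∀ n, γ ≤ ∑ i, x n i * v i)
    (ρ : κ → ℝ) (hρ : ∀ n, 0 ≤ ρ n) :
    γ * ∑ n, ρ n ≤ √(∑ i, (∑ n, ρ n * x n i) ^ 2) := by
  have h1 : γ * ∑ n, ρ n ≤ ∑ i, (∑ n, ρ n * x n i) * v i := by
    calc γ * ∑ n, ρ n = ∑ n, ρ n * γ := by rw [mul_comm, Finset.sum_mul]
      _ ≤ ∑ n, ρ n * ∑ i, x n i * v i :=
        Finset.sum_le_sum fun n _ => mul_le_mul_of_nonneg_left (hγ n) (hρ n)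
      _ = ∑ i, (∑ n, ρ n * x n i) * v i := by
        simp_rw [Finset.mul_sum, Finset.sum_mul, mul_assoc]
        exact Finset.sum_comm
  refine h1.trans ((Real.sum_mul_le_sqrt_mul_sqrt _ _ _).trans ?_)
  rw [hv, Real.sqrt_one, mul_one]

theorem stmt18
    (d N D : ℕ) (hd : 0 < d) (hN : 0 < N) (hD : 2 ≤ D) (hD2 : D = 2)
    (x : Fin N → Fin d → ℝ)
    (γ₂ : ℝ) (hγ₂pos : 0 < γ₂)
    (hγ₂ : IsGreatest {g : ℝ | ∃ v : Fin d → ℝ, (∑ i, (v i)^2) = 1 ∧ ∀ n, g ≤ ∑ i, x n i * v i} γ₂)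
    (α : ℝ) (hα : 0 < α)
    (up um : ℝ → Fin d → ℝ)
    (hinit : ∀ i, up 0 i = α ∧ um 0 i = α)
    (w : ℝ → Fin d → ℝ)
    (hw : ∀ t i, w t i = (up t i)^D - (um t i)^D)
    (hflowp : ∀ t, 0 ≤ t → ∀ i, HasDerivAt (fun s => up s i)
        (((D:ℝ)/(N:ℝ)) * (up t i)^(D-1) * ∑ n, Real.exp (-(∑ j, x n j * w t j)) * x n i) t)
    (hflowm : ∀ t, 0 ≤ t → ∀ i, HasDerivAt (fun s => um s i)
        (-(((D:ℝ)/(N:ℝ)) * (um t i)^(D-1) * ∑ n, Real.exp (-(∑ j, x n j * w t j)) * x n i)) t)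
    (Lf : ℝ → ℝ)
    (hLf : ∀ t, Lf t = (1 / (N:ℝ)) * ∑ n, Real.exp (-(∑ i, x n i * w t i)))
    (r : ℝ → Fin N → ℝ)
    (hr : ∀ t n, r t n = (1 / (N:ℝ)) * Real.exp (-(∑ i, x n i * w t i)))
    :
    ∀ t : ℝ, 0 ≤ t →
      8 * α^2 * γ₂ * (∫ τ in (0:ℝ)..t, Real.sqrt (∑ i, (∑ n, r τ n * x n i)^2)) ≤
        -Real.log (Lf t) := by
  subst hD2
  obtain ⟨⟨v, hv, hxv⟩, -⟩ := hγ₂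
  have hN' : (0 : ℝ) < N := by exact_mod_cast hN
  have : Nonempty (Fin N) := ⟨⟨0, hN⟩⟩
  have hrpos : ∀ t n, 0 < r t n := fun t n => by rw [hr]; positivity
  have hLr : ∀ t, Lf t = ∑ n, r t n := fun t => by simp_rw [hLf, hr, Finset.mul_sum]
  have hLpos : ∀ t, 0 < Lf t := fun t => by
    rw [hLr]; exact Finset.sum_pos (fun n _ => hrpos t n) Finset.univ_nonempty
  set s : ℝ → Fin d → ℝ := fun t i => ∑ n, r t n * x n i with hs
  have hsum : ∀ t i, ∑ n, Real.exp (-(∑ j, x n j * w t j)) * x n i = N * s t i := fun t i => by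
    simp only [hs, hr, Finset.mul_sum]
    refine Finset.sum_congr rfl fun n _ => ?_
    field_simp
  have hp : ∀ t, 0 ≤ t → ∀ i, HasDerivAt (fun s => up s i) (2 * s t i * up t i) t :=
    fun t ht i => (hflowp t ht i).congr_deriv (by rw [hsum]; field_simp; push_cast; ring)
  have hm : ∀ t, 0 ≤ t → ∀ i, HasDerivAt (fun s => um s i) (-(2 * s t i * um t i)) t :=
    fun t ht i => (hflowm t ht i).congr_deriv (by rw [hsum]; field_simp; push_cast; ring)
  have hprod : ∀ t, 0 ≤ t → ∀ i, up t i * um t i = α ^ 2 := fun t ht i => by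
    rw [mul_eq_of_hasDerivAt_opposite_rates (f := fun s => up s i) (g := fun s => um s i)
      (c := fun t => 2 * s t i) (fun t ht => hp t ht i) (fun t ht => hm t ht i) ht,
      (hinit i).1, (hinit i).2, sq]
  have hw' : ∀ t, 0 ≤ t → ∀ i, HasDerivAt (fun s => w s i)
      (4 * ((up t i) ^ 2 + (um t i) ^ 2) * s t i) t := fun t ht i => by
    simp_rw [hw]
    exact (((hp t ht i).fun_pow 2).sub ((hm t ht i).fun_pow 2)).congr_deriv (by push_cast; ring)
  have hr' : ∀ t, 0 ≤ t → ∀ n, HasDerivAt (fun s => r s n)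
      (-(r t n * ∑ i, x n i * (4 * ((up t i) ^ 2 + (um t i) ^ 2) * s t i))) t := fun t ht n => by
    have h := (HasDerivAt.fun_sum (u := Finset.univ)
      fun i _ => (hw' t ht i).const_mul (x n i)).fun_neg.exp.const_mul (1 / (N : ℝ))
    simp_rw [hr]
    exact h.congr_deriv (by ring)
  have hL' : ∀ t, 0 ≤ t → HasDerivAt Lf
      (-∑ i, 4 * ((up t i) ^ 2 + (um t i) ^ 2) * (s t i) ^ 2) t := fun t ht => by
    have h := HasDerivAt.fun_sum (u := Finset.univ) fun n _ => hr' t ht n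
    rw [funext hLr]
    refine h.congr_deriv ?_
    rw [Finset.sum_neg_distrib, neg_inj]
    simp_rw [Finset.mul_sum]
    rw [Finset.sum_comm]
    refine Finset.sum_congr rfl fun i _ => ?_
    simp_rw [← mul_assoc (r t _)]
    rw [← Finset.sum_mul]
    change s t i * _ = _
    ring
  have hlog : ∀ t, 0 ≤ t → HasDerivAt (fun t => -Real.log (Lf t))
      (-((-∑ i, 4 * ((up t i) ^ 2 + (um t i) ^ 2) * (s t i) ^ 2) / Lf t)) t :=
    fun t ht => ((hL' t ht).log (hLpos t).ne').fun_neg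
  have hL0 : Lf 0 = 1 := by
    have h0 : ∀ i, w 0 i = 0 := fun i => by rw [hw, (hinit i).1, (hinit i).2, sub_self]
    rw [hLf]
    simp [h0, hN'.ne']
  have hbound : ∀ t, 0 ≤ t → 8 * α ^ 2 * γ₂ * √(∑ i, (s t i) ^ 2) ≤
      -((-∑ i, 4 * ((up t i) ^ 2 + (um t i) ^ 2) * (s t i) ^ 2) / Lf t) := fun t ht => by
    have h1 : γ₂ * Lf t ≤ √(∑ i, (s t i) ^ 2) := by
      rw [hLr]
      exact margin_mul_sum_le_sqrt x v hv hxv (r t) fun n => (hrpos t n).le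
    have h2 : 8 * α ^ 2 * ∑ i, (s t i) ^ 2 ≤
        ∑ i, 4 * ((up t i) ^ 2 + (um t i) ^ 2) * (s t i) ^ 2 := by
      rw [Finset.mul_sum]
      refine Finset.sum_le_sum fun i _ => mul_le_mul_of_nonneg_right ?_ (sq_nonneg _)
      nlinarith [hprod t ht i, sq_nonneg (up t i - um t i)]
    rw [neg_div, neg_neg, le_div_iff₀ (hLpos t)]
    refine le_trans ?_ h2
    have h3 := Real.sq_sqrt (Finset.sum_nonneg fun i (_ : i ∈ Finset.univ) => sq_nonneg (s t i))
    calc 8 * α ^ 2 * γ₂ * √(∑ i, (s t i) ^ 2) * Lf t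
        = 8 * α ^ 2 * (√(∑ i, (s t i) ^ 2) * (γ₂ * Lf t)) := by ring
      _ ≤ 8 * α ^ 2 * (√(∑ i, (s t i) ^ 2) * √(∑ i, (s t i) ^ 2)) := by gcongr
      _ = 8 * α ^ 2 * ∑ i, (s t i) ^ 2 := by rw [← sq, h3]
  intro t ht
  have hcont : ContinuousOn (fun τ => 8 * α ^ 2 * γ₂ * √(∑ i, (s τ i) ^ 2)) (Set.Icc 0 t) := by
    intro τ hτ
    have hrc : ∀ n, ContinuousAt (fun τ => r τ n) τ := fun n => (hr' τ hτ.1 n).continuousAt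
    refine ContinuousAt.continuousWithinAt ?_
    simp only [hs]
    fun_prop
  have h := intervalIntegral.integral_le_sub_of_hasDeriv_right_of_le ht
    (fun τ hτ => (hlog τ hτ.1).continuousAt.continuousWithinAt)
    (fun τ hτ => (hlog τ hτ.1.le).hasDerivWithinAt) hcont.integrableOn_Icc
    (fun τ hτ => hbound τ hτ.1.le)
  rw [intervalIntegral.integral_const_mul] at h
  simpa [hL0] using h
end
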